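/- If M is a connected lattice path matroid whose matroid polytope P_M is Gorenstein, then the h*-vector (h*₀, h*₁, …, h*_d) of P_M is unimodal, i.e., there exists an index t with h*₀ ≤ h*₁ ≤ ⋯ ≤ h*_t ≥ h*_{t+1} ≥ ⋯ ≥ h*_d. -/

import Mathlib

/-!
Statement 9: If the base polytope of a connected lattice path matroid is Gorenstein,
then its `h*`-vector is unimodal.
-/

open scoped Classical Pointwise

/-- The height of the lattice path associated to `A ⊆ [n]` after `i` steps:
the number of north steps (elements of `A`) among the first `i` steps. -/
def pathHeight {n : ℕ} (A : Finset (Fin n)) (i : ℕ) : ℕ :=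
  (A.filter fun j => j.val < i).card

/-- The bases of the lattice path matroid `M[U,L]`: all subsets of size `|U|`
whose lattice path stays weakly between the lower path `L` and the upper path `U`. -/
noncomputable def lpmBases {n : ℕ} (U L : Finset (Fin n)) : Finset (Finset (Fin n)) :=
  Finset.univ.filter fun B => B.card = U.card ∧
    ∀ i ∈ Finset.range (n + 1), pathHeight L i ≤ pathHeight B i ∧ pathHeight B i ≤ pathHeight U i

/-- `(U, L)` is a valid pair of boundary lattice paths: same number of north steps and
`U` weakly above `L`. -/
def IsLPMPair {n : ℕ} (U L : Finset (Fin n)) : Prop :=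
  U.card = L.card ∧ ∀ i, pathHeight L i ≤ pathHeight U i

/-- The diagram of `M[U,L]` is connected: `U` and `L` meet only at the two endpoints. -/
def ConnectedDiagram {n : ℕ} (U L : Finset (Fin n)) : Prop :=
  ∀ i : ℕ, 0 < i → i < n → pathHeight L i < pathHeight U i

/-- The unit cell with lower-left corner `(x, y)` belongs to the diagram of `M[U,L]`. -/
def CellInDiagram {n : ℕ} (U L : Finset (Fin n)) (x y : ℕ) : Prop :=
  pathHeight L (x + y + 1) ≤ y ∧ y + 1 ≤ pathHeight U (x + y + 1)

/-- The 0/1 indicator vector of a subset of `[n]`. -/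
def indVec {n : ℕ} (B : Finset (Fin n)) : Fin n → ℝ :=
  fun i => if i ∈ B then 1 else 0

/-- The matroid (base) polytope of the lattice path matroid `M[U,L]`. -/
noncomputable def lpmPolytope {n : ℕ} (U L : Finset (Fin n)) : Set (Fin n → ℝ) :=
  convexHull ℝ {x | ∃ B ∈ lpmBases U L, x = indVec B}

section Unimodal

variable {n : ℕ}

/-- The number of lattice (integer) points of a subset of `ℝⁿ`. -/
noncomputable def latticeCount (S : Set (Fin n → ℝ)) : ℕ :=
  Set.ncard {x ∈ S | ∀ i, ∃ m : ℤ, x i = (m : ℝ)}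

/-- A lattice polytope `P` is `δ`-Gorenstein (`δ P` is reflexive): via Ehrhart
reciprocity, the lattice points in the relative interior of `(δ + t) P` are counted by
the Ehrhart polynomial of `P` at `t`, for every `t ≥ 0`. -/
def IsGorensteinOfIndex (P : Set (Fin n → ℝ)) (δ : ℕ) : Prop :=
  ∀ t : ℕ, latticeCount (intrinsicInterior ℝ ((((δ + t : ℕ) : ℝ)) • P)) =
    latticeCount ((t : ℝ) • P)

/-- A lattice polytope is Gorenstein if it is `δ`-Gorenstein for some positive
integer `δ`. -/
def IsGorenstein (P : Set (Fin n → ℝ)) : Prop :=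
  ∃ δ : ℕ, 1 ≤ δ ∧ IsGorensteinOfIndex P δ

/-- `h` is the `h*`-vector of the lattice polytope `P` of dimension `d`:
`L_P(t) = ∑_{k=0}^{d} h_k · C(t + d - k, d)` for all `t ≥ 0`, and `h` vanishes beyond
degree `d`.  This encodes `∑_{t≥0} L_P(t) z^t = (∑_k h_k z^k)/(1-z)^{d+1}`. -/
def IsHStarVector (P : Set (Fin n → ℝ)) (d : ℕ) (h : ℕ → ℕ) : Prop :=
  (∀ t : ℕ, latticeCount ((t : ℝ) • P) =
      ∑ k ∈ Finset.range (d + 1), h k * Nat.choose (t + d - k) d) ∧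
  ∀ k, d < k → h k = 0

open PowerSeries in
/-- The cone of `γ`-nonnegative power series with center `c / 2`. -/
noncomputable def gammaCone (c : ℕ) : AddSubmonoid (PowerSeries ℤ) :=
  AddSubmonoid.closure {p | ∃ j m : ℕ, 2 * j + m = c ∧ p = X ^ j * (1 + X) ^ m}

section Gamma

open PowerSeries

theorem gammaCone_basis_mem {c j m : ℕ} (h : 2 * j + m = c) :
    (X ^ j * (1 + X) ^ m : PowerSeries ℤ) ∈ gammaCone c :=
  AddSubmonoid.subset_closure ⟨j, m, h, rfl⟩

theorem gammaCone_mul_mem {c d : ℕ} {p q : PowerSeries ℤ}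
    (hp : p ∈ gammaCone c) (hq : q ∈ gammaCone d) : p * q ∈ gammaCone (c + d) := by
  induction hp using AddSubmonoid.closure_induction with
  | zero => simp
  | add x y _ _ hx hy => rw [add_mul]; exact add_mem hx hy
  | mem x hx =>
    obtain ⟨j, m, hjm, rfl⟩ := hx
    induction hq using AddSubmonoid.closure_induction with
    | zero => simp
    | add x y _ _ hx hy => rw [mul_add]; exact add_mem hx hy
    | mem y hy =>
      obtain ⟨j', m', hjm', rfl⟩ := hy
      have : (X ^ j * (1 + X) ^ m * (X ^ j' * (1 + X) ^ m') : PowerSeries ℤ)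
          = X ^ (j + j') * (1 + X) ^ (m + m') := by ring
      rw [this]
      exact gammaCone_basis_mem (by omega)

theorem gammaCone_prod_mem {α : Type*} (s : Finset α) (c : α → ℕ) (p : α → PowerSeries ℤ)
    (h : ∀ i ∈ s, p i ∈ gammaCone (c i)) : ∏ i ∈ s, p i ∈ gammaCone (∑ i ∈ s, c i) := by
  induction s using Finset.induction_on with
  | empty => simpa using gammaCone_basis_mem (c := 0) (j := 0) (m := 0) rfl
  | insert a s ha ih =>
    rw [Finset.prod_insert ha, Finset.sum_insert ha]
    exact gammaCone_mul_mem (h a (by simp)) (ih fun i hi => h i (by simp [hi]))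

theorem coeff_X_pow_mul_one_add_X_pow (j m k : ℕ) :
    coeff k (X ^ j * (1 + X) ^ m : PowerSeries ℤ) = if j ≤ k then (m.choose (k - j) : ℤ) else 0 := by
  have : ((1 + X) ^ m : PowerSeries ℤ) = (((1 + Polynomial.X) ^ m : Polynomial ℤ) : PowerSeries ℤ) := by
    simp
  rw [coeff_X_pow_mul', this, Polynomial.coeff_coe, Polynomial.coeff_one_add_X_pow]

theorem coeff_le_succ_of_mem_gammaCone {c k : ℕ} {p : PowerSeries ℤ} (hp : p ∈ gammaCone c)
    (hk : 2 * k + 1 ≤ c) : coeff k p ≤ coeff (k + 1) p := by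
  induction hp using AddSubmonoid.closure_induction with
  | zero => simp
  | add x y _ _ hx hy => simpa using add_le_add hx hy
  | mem x hx =>
    obtain ⟨j, m, hjm, rfl⟩ := hx
    rw [coeff_X_pow_mul_one_add_X_pow, coeff_X_pow_mul_one_add_X_pow]
    by_cases h : j ≤ k
    · rw [if_pos h, if_pos (by omega), show k + 1 - j = (k - j) + 1 by omega]
      norm_cast
      rcases Nat.lt_or_ge (k - j) (m / 2) with h' | h'
      · exact Nat.choose_le_succ_of_lt_half_left h'
      · exact le_of_eq (Nat.choose_symm_of_eq_add (by omega))
    · rw [if_neg h]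
      split_ifs <;> positivity

theorem coeff_succ_le_of_mem_gammaCone {c k : ℕ} {p : PowerSeries ℤ} (hp : p ∈ gammaCone c)
    (hk : c ≤ 2 * k + 1) : coeff (k + 1) p ≤ coeff k p := by
  induction hp using AddSubmonoid.closure_induction with
  | zero => simp
  | add x y _ _ hx hy => simpa using add_le_add hx hy
  | mem x hx =>
    obtain ⟨j, m, hjm, rfl⟩ := hx
    have hj : j ≤ k := by omega
    rw [coeff_X_pow_mul_one_add_X_pow, coeff_X_pow_mul_one_add_X_pow, if_pos hj,
      if_pos (by omega), show k + 1 - j = (k - j) + 1 by omega]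
    norm_cast
    rcases Nat.lt_or_ge m (k - j + 1) with h | h
    · simp [Nat.choose_eq_zero_of_lt h]
    · rcases Nat.lt_or_ge (m - (k - j + 1)) (m / 2) with h' | h'
      · have := Nat.choose_le_succ_of_lt_half_left h'
        rwa [Nat.choose_symm h, show m - (k - j + 1) + 1 = m - (k - j) by omega,
          Nat.choose_symm (by omega)] at this
      · exact le_of_eq (Nat.choose_symm_of_eq_add (by omega))

/-- The Eulerian polynomial `∑ z ^ des`, as a power series. -/
noncomputable def eulerian (a : ℕ) : PowerSeries ℤ :=
  (1 - X) ^ (a + 1) * PowerSeries.mk fun u => ((u : ℤ) + 1) ^ a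

theorem eulerian_one : eulerian 1 = 1 := by
  have h := PowerSeries.mk_add_choose_mul_one_sub_pow_eq_one ℤ 1
  rw [eulerian, mul_comm]
  refine Eq.trans ?_ h
  congr 1
  ext u
  simp
  ring

theorem eulerian_succ (a : ℕ) : eulerian (a + 1) =
    (1 + (a : PowerSeries ℤ) * X) * eulerian a + X * (1 - X) * d⁄dX ℤ (eulerian a) := by
  set S : PowerSeries ℤ := PowerSeries.mk fun u => ((u : ℤ) + 1) ^ a with hS
  have h1 : (PowerSeries.mk fun u => ((u : ℤ) + 1) ^ (a + 1)) = S + X * d⁄dX ℤ S := by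
    ext u
    cases u with
    | zero => simp [hS]
    | succ u =>
      rw [map_add, coeff_succ_X_mul, coeff_derivative, coeff_mk, hS, coeff_mk]
      push_cast; ring
  have h2 : d⁄dX ℤ (eulerian a) = (1 - X) ^ (a + 1) * d⁄dX ℤ S
      - ((a : PowerSeries ℤ) + 1) * (1 - X) ^ a * S := by
    rw [eulerian, ← hS, Derivation.leibniz, Derivation.leibniz_pow]
    simp
    ring
  rw [h2, eulerian, eulerian, h1, ← hS]
  ring

theorem eulerian_mem_gammaCone (a : ℕ) : eulerian (a + 1) ∈ gammaCone a := by
  induction a with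
  | zero =>
    rw [eulerian_one]
    simpa using gammaCone_basis_mem (c := 0) (j := 0) (m := 0) rfl
  | succ a ih =>
    rw [eulerian_succ]
    generalize eulerian (a + 1) = p at ih
    induction ih using AddSubmonoid.closure_induction with
    | zero => simp
    | add x y _ _ hx hy =>
      rw [map_add]
      convert add_mem hx hy using 1
      ring
    | mem x hx =>
      obtain ⟨j, m, hjm, rfl⟩ := hx
      have key : (1 + ((a + 1 : ℕ) : PowerSeries ℤ) * X) * (X ^ j * (1 + X) ^ m)
          + X * (1 - X) * d⁄dX ℤ (X ^ j * (1 + X) ^ m)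
          = (j + 1) • (X ^ j * (1 + X) ^ (m + 1))
            + (2 * m) • (X ^ (j + 1) * (1 + X) ^ (m - 1)) := by
        rw [Derivation.leibniz, Derivation.leibniz_pow, Derivation.leibniz_pow, ← hjm]
        rcases j with _ | j <;> rcases m with _ | m <;> simp <;> ring
      rw [key]
      refine add_mem (nsmul_mem (gammaCone_basis_mem (by omega)) _) ?_
      rcases m with _ | m
      · simp
      · exact nsmul_mem (gammaCone_basis_mem (by omega)) _

end Gamma

section OrdinalSum

open PowerSeries

variable {E : Type*} [Fintype E]

theorem sup_univ_eq_iff (x : E → ℕ) (T : ℕ) :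
    Finset.univ.sup x = T ↔ (∀ e, x e ≤ T) ∧ (T = 0 ∨ ∃ e, x e = T) := by
  constructor
  · rintro rfl
    refine ⟨fun e => Finset.le_sup (Finset.mem_univ e), ?_⟩
    rcases isEmpty_or_nonempty E with h | h
    · left; simp
    · right
      obtain ⟨e, -, he⟩ := Finset.exists_mem_eq_sup Finset.univ Finset.univ_nonempty x
      exact ⟨e, he.symm⟩
  · rintro ⟨h1, h2⟩
    apply le_antisymm (Finset.sup_le fun e _ => h1 e)
    rcases h2 with rfl | ⟨e, rfl⟩
    · exact Nat.zero_le _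
    · exact Finset.le_sup (Finset.mem_univ e)

/-- Maps with maximum `T` from the ordinal sum of the antichains `β = 0, …, β = j - 1`,
extended by zero. -/
noncomputable def ordMaps (β : E → ℕ) (j T : ℕ) : Finset (E → ℕ) :=
  (Fintype.piFinset fun _ => Finset.range (T + 1)).filter fun x =>
    (∀ e, j ≤ β e → x e = 0) ∧ Finset.univ.sup x = T ∧
      ∀ e e', β e < β e' → β e' < j → x e ≤ x e'

/-- Maps with maximum `u` supported on the antichain `β = j`. -/
noncomputable def blockMaps (β : E → ℕ) (j u : ℕ) : Finset (E → ℕ) :=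
  (Fintype.piFinset fun _ => Finset.range (u + 1)).filter fun x =>
    (∀ e, β e ≠ j → x e = 0) ∧ Finset.univ.sup x = u

theorem mem_ordMaps {β : E → ℕ} {j T : ℕ} {x : E → ℕ} : x ∈ ordMaps β j T ↔
    (∀ e, j ≤ β e → x e = 0) ∧ ((∀ e, x e ≤ T) ∧ (T = 0 ∨ ∃ e, x e = T)) ∧
      ∀ e e', β e < β e' → β e' < j → x e ≤ x e' := by
  rw [ordMaps, Finset.mem_filter, sup_univ_eq_iff, Fintype.mem_piFinset]
  simp only [Finset.mem_range, Nat.lt_succ_iff]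
  tauto

theorem mem_blockMaps {β : E → ℕ} {j u : ℕ} {x : E → ℕ} : x ∈ blockMaps β j u ↔
    (∀ e, β e ≠ j → x e = 0) ∧ ((∀ e, x e ≤ u) ∧ (u = 0 ∨ ∃ e, x e = u)) := by
  rw [blockMaps, Finset.mem_filter, sup_univ_eq_iff, Fintype.mem_piFinset]
  simp only [Finset.mem_range, Nat.lt_succ_iff]
  tauto

theorem card_ordMaps_succ (β : E → ℕ) (j T : ℕ) (hj : ∃ e, β e = j) :
    (ordMaps β (j + 1) T).card =
      ∑ p ∈ Finset.HasAntidiagonal.antidiagonal T, (ordMaps β j p.1).card * (blockMaps β j p.2).card := by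
  let lower : (E → ℕ) → E → ℕ := fun x e => if β e < j then x e else 0
  let f : (E → ℕ) → ℕ × ℕ := fun x => (Finset.univ.sup (lower x), T - Finset.univ.sup (lower x))
  have hlow : ∀ x ∈ ordMaps β (j + 1) T, Finset.univ.sup (lower x) ≤ T := by
    intro x hx
    rw [mem_ordMaps] at hx
    refine Finset.sup_le fun e _ => ?_
    simp only [lower]
    split_ifs
    · exact hx.2.1.1 e
    · exact Nat.zero_le _
  have hf : ∀ x ∈ ordMaps β (j + 1) T, f x ∈ Finset.HasAntidiagonal.antidiagonal T := by
    intro x hx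
    have := hlow x hx
    simp only [f, Finset.HasAntidiagonal.mem_antidiagonal]
    omega
  rw [Finset.card_eq_sum_card_fiberwise hf]
  refine Finset.sum_congr rfl ?_
  rintro ⟨s, u⟩ hsu
  simp only [Finset.HasAntidiagonal.mem_antidiagonal] at hsu
  rw [← Finset.card_product]
  refine Finset.card_nbij'
    (fun x => (lower x, fun e => if β e = j then x e - s else 0))
    (fun p e => if β e < j then p.1 e else if β e = j then s + p.2 e else 0) ?_ ?_ ?_ ?_
  · intro x hx
    simp only [Finset.coe_filter, Set.mem_ofPred_eq, f, Prod.mk.injEq] at hx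
    obtain ⟨hx, hs, -⟩ := hx
    rw [sup_univ_eq_iff] at hs
    rw [mem_ordMaps] at hx
    obtain ⟨h0, ⟨hT, hT'⟩, hm⟩ := hx
    simp only [Finset.coe_product, Set.mem_prod, Finset.mem_coe, mem_ordMaps, mem_blockMaps]
    refine ⟨⟨?_, hs, ?_⟩, ?_, ?_, ?_⟩
    · intro e he
      simp [lower, not_lt.2 he]
    · intro e e' h1 h2
      simp only [lower, if_pos h2, if_pos (h1.trans h2)]
      exact hm e e' h1 (by omega)
    · intro e he
      simp [he]
    · intro e
      have := hT e
      split_ifs <;> omega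
    · rcases Nat.eq_zero_or_pos u with hu | hu
      · exact Or.inl hu
      · right
        obtain ⟨e, he⟩ := hT'.resolve_left (by omega)
        have hle := hs.1 e
        refine ⟨e, ?_⟩
        have hej : β e = j := by
          by_contra hne
          rcases Nat.lt_or_ge (β e) j with h | h
          · simp only [lower, if_pos h] at hle
            omega
          · have := h0 e (by omega)
            omega
        simp only [if_pos hej]
        omega
  · rintro ⟨y, z⟩ hyz
    simp only [Finset.coe_product, Set.mem_prod, Finset.mem_coe, mem_ordMaps, mem_blockMaps] at hyz
    obtain ⟨⟨hy0, ⟨hys, hys'⟩, hym⟩, hz0, hzu, hzu'⟩ := hyz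
    have hl : lower (fun e => if β e < j then y e else if β e = j then s + z e else 0) = y := by
      funext e
      simp only [lower]
      split_ifs with h
      · rfl
      · rw [hy0 e (by omega)]
    have hs : Finset.univ.sup y = s := (sup_univ_eq_iff _ _).2 ⟨hys, hys'⟩
    simp only [Finset.coe_filter, Set.mem_ofPred_eq, f, hl, hs, Prod.mk.injEq, true_and, mem_ordMaps]
    refine ⟨⟨?_, ⟨?_, ?_⟩, ?_⟩, by omega⟩
    · intro e he
      rw [if_neg (by omega), if_neg (by omega)]
    · intro e
      have := hys e
      have := hzu e
      split_ifs <;> omega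
    · right
      rcases Nat.eq_zero_or_pos u with hu | hu
      · obtain ⟨e, he⟩ := hj
        have := hzu e
        refine ⟨e, ?_⟩
        rw [if_neg (by omega), if_pos he]
        omega
      · obtain ⟨e, he⟩ := hzu'.resolve_left (by omega)
        have hej : β e = j := by
          by_contra hne
          have := hz0 e hne
          omega
        refine ⟨e, ?_⟩
        rw [if_neg (by omega), if_pos hej]
        omega
    · intro e e' h1 h2
      have := hys e
      rw [if_pos (by omega : β e < j)]
      split_ifs with h3 h4
      · exact hym e e' h1 h3
      · omega
      · omega
  · intro x hx
    simp only [Finset.coe_filter, Set.mem_ofPred_eq, f, Prod.mk.injEq] at hx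
    obtain ⟨hx, hs, -⟩ := hx
    rw [mem_ordMaps] at hx
    obtain ⟨h0, -, hm⟩ := hx
    funext e
    simp only [lower]
    split_ifs with h1 h2
    · rfl
    · have : s ≤ x e := by
        rw [← hs]
        refine Finset.sup_le fun e' _ => ?_
        simp only [lower]
        split_ifs with h
        · exact hm e' e (by omega) (by omega)
        · exact Nat.zero_le _
      omega
    · exact (h0 e (by omega)).symm
  · rintro ⟨y, z⟩ hyz
    simp only [Finset.coe_product, Set.mem_prod, Finset.mem_coe, mem_ordMaps, mem_blockMaps] at hyz
    obtain ⟨⟨hy0, -, -⟩, hz0, -⟩ := hyz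
    refine Prod.ext (funext fun e => ?_) (funext fun e => ?_)
    · simp only [lower]
      split_ifs with h
      · rfl
      · exact (hy0 e (by omega)).symm
    · dsimp only
      split_ifs with h1 h2
      · omega
      · omega
      · exact (hz0 e h1).symm

theorem mk_card_blockMaps (β : E → ℕ) (j : ℕ) :
    (PowerSeries.mk fun u => ((blockMaps β j u).card : ℤ)) =
      (1 - X) * PowerSeries.mk fun u =>
        ((u : ℤ) + 1) ^ (Finset.univ.filter fun e => β e = j).card := by
  let S : ℕ → Finset (E → ℕ) := fun u =>
    Fintype.piFinset fun e => if β e = j then Finset.range (u + 1) else {0}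
  have hmem : ∀ u x, x ∈ S u ↔ (∀ e, β e ≠ j → x e = 0) ∧ ∀ e, x e ≤ u := by
    intro u x
    simp only [S, Fintype.mem_piFinset]
    rw [← forall_and]
    refine forall_congr' fun e => ?_
    split_ifs with h
    · simp [h]
    · simp only [Finset.mem_singleton]
      constructor
      · intro h'; simp [h']
      · intro h'; exact h'.1 h
  have hS : ∀ u, ((S u).card : ℤ) = ((u : ℤ) + 1) ^ (Finset.univ.filter fun e => β e = j).card := by
    intro u
    simp only [S, Fintype.card_piFinset]
    have : ∀ e, (if β e = j then Finset.range (u + 1) else {0}).card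
        = if β e = j then u + 1 else 1 := by
      intro e; split_ifs <;> simp
    simp only [this]
    rw [Finset.prod_ite]
    simp
  ext u
  rw [sub_mul, one_mul, map_sub, coeff_mk, coeff_mk]
  cases u with
  | zero =>
    have : blockMaps β j 0 = S 0 := by
      ext x
      rw [mem_blockMaps, hmem]
      simp
    rw [this, hS]
    simp
  | succ u =>
    rw [coeff_succ_X_mul, coeff_mk, ← hS, ← hS]
    have hsub : S u ⊆ S (u + 1) := by
      intro x
      rw [hmem, hmem]
      exact fun h => ⟨h.1, fun e => (h.2 e).trans (Nat.le_succ u)⟩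
    have : blockMaps β j (u + 1) = S (u + 1) \ S u := by
      ext x
      rw [Finset.mem_sdiff, mem_blockMaps, hmem, hmem]
      constructor
      · rintro ⟨h1, h2, h3⟩
        refine ⟨⟨h1, h2⟩, fun h => ?_⟩
        obtain ⟨e, he⟩ := h3.resolve_left (by omega)
        have := h.2 e
        omega
      · rintro ⟨⟨h1, h2⟩, h3⟩
        refine ⟨h1, h2, Or.inr ?_⟩
        by_contra! h4
        refine h3 ⟨h1, fun e => ?_⟩
        have := h2 e
        have := h4 e
        omega
    rw [this, Finset.card_sdiff_of_subset hsub, Nat.cast_sub (Finset.card_le_card hsub)]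

theorem mk_card_ordMaps (β : E → ℕ) (b : ℕ) (hb : ∀ j < b, ∃ e, β e = j) :
    (PowerSeries.mk fun T => ((ordMaps β b T).card : ℤ)) =
      ∏ j ∈ Finset.range b, PowerSeries.mk fun u => ((blockMaps β j u).card : ℤ) := by
  induction b with
  | zero =>
    ext T
    rw [coeff_mk, Finset.range_zero, Finset.prod_empty, coeff_one]
    split_ifs with h
    · subst h
      have : ordMaps β 0 0 = {0} := by
        ext x
        rw [mem_ordMaps, Finset.mem_singleton]
        constructor
        · intro h; funext e; exact h.1 e (Nat.zero_le _)
        · rintro rfl; simp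
      simp [this]
    · have : ordMaps β 0 T = ∅ := by
        refine Finset.eq_empty_of_forall_notMem fun x hx => ?_
        rw [mem_ordMaps] at hx
        obtain ⟨e, he⟩ := hx.2.1.2.resolve_left h
        have := hx.1 e (Nat.zero_le _)
        omega
      simp [this]
  | succ b ih =>
    rw [Finset.prod_range_succ, ← ih fun j hj => hb j (by omega)]
    ext T
    rw [coeff_mul, coeff_mk, card_ordMaps_succ β b T (hb b (by omega))]
    simp

theorem one_sub_pow_mul_mk_card_ordMaps (β : E → ℕ) (b : ℕ) (hb : ∀ j < b, ∃ e, β e = j)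
    (hβ : ∀ e, β e < b) :
    (1 - X) ^ Fintype.card E * (PowerSeries.mk fun T => ((ordMaps β b T).card : ℤ)) ∈
      gammaCone (Fintype.card E - b) := by
  have hcard : Fintype.card E =
      ∑ j ∈ Finset.range b, (Finset.univ.filter fun e => β e = j).card := by
    rw [← Finset.card_univ]
    exact Finset.card_eq_sum_card_fiberwise fun e _ => by simpa using hβ e
  have hpos : ∀ j ∈ Finset.range b, 1 ≤ (Finset.univ.filter fun e => β e = j).card := by
    intro j hj
    obtain ⟨e, he⟩ := hb j (Finset.mem_range.1 hj)
    exact Finset.card_pos.2 ⟨e, by simp [he]⟩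
  have hdeg : Fintype.card E - b =
      ∑ j ∈ Finset.range b, ((Finset.univ.filter fun e => β e = j).card - 1) := by
    rw [Finset.sum_tsub_distrib _ hpos, ← hcard]
    simp
  rw [mk_card_ordMaps β b hb, hdeg, hcard, ← Finset.prod_pow_eq_pow_sum, ← Finset.prod_mul_distrib]
  refine gammaCone_prod_mem _ _ _ fun j hj => ?_
  have := eulerian_mem_gammaCone ((Finset.univ.filter fun e => β e = j).card - 1)
  rw [Nat.sub_add_cancel (hpos j hj), eulerian, pow_succ] at this
  rwa [mk_card_blockMaps, ← mul_assoc]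

end OrdinalSum

section Cells

variable {E ι : Type*}

/-- Normalized integer solutions at level `t` of the system of difference constraints
`f (src a) ≤ f (dst a) + c a * t`. -/
def IsSol (o : E) (src dst : ι → E) (c : ι → ℤ) (t : ℤ) (f : E → ℤ) : Prop :=
  f o = 0 ∧ ∀ a, f (src a) ≤ f (dst a) + c a * t

/-- The data of a saturated cell: `m` chooses a lift of each element to the line, and `β`
arranges the lifts in consecutive blocks of alternating parity. -/
structure IsCell (o : E) (src dst : ι → E) (c : ι → ℤ) (δ : ℕ) (q m : E → ℤ) (β : E → ℕ) :
    Prop where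
  m_base : m o = 0
  β_base : β o = 0
  surj : ∀ e, ∀ i < β e, ∃ e', β e' = i
  parity : ∀ e, (2 : ℤ) ∣ q e + δ * m e - β e
  constr : ∀ a, 0 < c a + m (src a) - m (dst a) ∨
    (c a + m (src a) - m (dst a) = 0 ∧ β (src a) < β (dst a))

/-- `f` is the solution at level `t` encoded by the point `x` of the cell `(m, β)`. -/
def Decodes (o : E) (δ : ℕ) (q : E → ℤ) (t : ℤ) (m : E → ℤ) (β x : E → ℕ) (f : E → ℤ) : Prop :=
  ∀ e, 2 * f e + q e = 2 * x e + β e - 2 * x o - (2 * t + δ) * m e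

variable {o : E} {src dst : ι → E} {c : ι → ℤ} {δ : ℕ} {q m : E → ℤ} {β : E → ℕ}

theorem IsCell.exists_decodes (h : IsCell o src dst c δ q m β) (t : ℤ) (x : E → ℕ) :
    ∃ f, Decodes o δ q t m β x f := by
  choose k hk using h.parity
  refine ⟨fun e => x e - x o - t * m e - k e, fun e => ?_⟩
  linear_combination hk e

theorem eq_of_alternating {β' G : E → ℕ} (hpar : ∀ e, β e % 2 = β' e % 2)
    (hs : ∀ e, ∀ i < β e, ∃ e', β e' = i) (hs' : ∀ e, ∀ i < β' e, ∃ e', β' e' = i)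
    (hm : ∀ u v, β u < β v → G u < G v) (hm' : ∀ u v, β' u < β' v → G u < G v) : β = β' := by
  funext e
  induction hn : G e using Nat.strong_induction_on generalizing e with
  | _ n ih =>
    have hp := hpar e
    rcases lt_trichotomy (β e) (β' e) with h | h | h
    · obtain ⟨e', he'⟩ := hs' e (β' e - 1) (by omega)
      have h1 := hm' e' e (by omega)
      have h2 := ih _ (hn ▸ h1) e' rfl
      have h3 := hm e e' (by omega)
      omega
    · exact h
    · obtain ⟨e', he'⟩ := hs e (β e - 1) (by omega)
      have h1 := hm e' e (by omega)
      have h2 := ih _ (hn ▸ h1) e' rfl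
      have h3 := hm' e e' (by omega)
      omega

theorem int_eq_of_sub_eq_mul {N x y k : ℤ} (hx : 0 ≤ x) (hxN : x < N) (hy : 0 ≤ y) (hyN : y < N)
    (h : x - y = N * k) : k = 0 := by
  rcases lt_trichotomy k 0 with hk | hk | hk
  · nlinarith
  · exact hk
  · nlinarith

/-- Among the lifts `F e + N * j` there is a largest negative odd one, and it is at least `-N`. -/
theorem exists_greatest_odd_lift {F : E → ℤ} {N : ℤ} (hN : 0 < N) (ho : F o = 0)
    (hodd : ∃ e, Odd (F e) ∨ Odd N) :
    ∃ M : ℤ, -N ≤ M ∧ M < 0 ∧ Odd M ∧ (∃ e j, M = F e + N * j) ∧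
      ∀ v < 0, Odd v → (∃ e j, v = F e + N * j) → v ≤ M := by
  have hne : ∃ v : ℤ, v < 0 ∧ Odd v ∧ ∃ e j, v = F e + N * j := by
    obtain ⟨e, he⟩ := hodd
    rcases Int.even_or_odd N with hev | hod
    · refine ⟨F e + N * (-|F e| - 1), ?_, ?_, e, _, rfl⟩
      · have h1 := le_abs_self (F e)
        have h2 := abs_nonneg (F e)
        nlinarith
      · refine (he.resolve_right ?_).add_even (hev.mul_right _)
        rwa [Int.not_odd_iff_even]
    · exact ⟨-N, by omega, by simpa using hod, o, -1, by rw [ho]; ring⟩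
  obtain ⟨M, ⟨hM0, hModd, e, j, hM⟩, hmax⟩ := Int.exists_greatest_of_bdd
    (P := fun v => v < 0 ∧ Odd v ∧ ∃ e j, v = F e + N * j) ⟨0, fun v hv => hv.1.le⟩ hne
  refine ⟨M, ?_, hM0, hModd, ⟨e, j, hM⟩, fun v h1 h2 h3 => hmax v ⟨h1, h2, h3⟩⟩
  rcases Int.even_or_odd N with hev | hod
  · by_contra! hlt
    have := hmax (M + N) ⟨by omega, hModd.add_even hev, e, j + 1, by rw [hM]; ring⟩
    omega
  · exact hmax _ ⟨by omega, by simpa using hod, o, -1, by rw [ho]; ring⟩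

variable [Fintype E]

theorem IsCell.lt_sup_succ (e : E) : β e < Finset.univ.sup β + 1 :=
  Nat.lt_succ_of_le (Finset.le_sup (Finset.mem_univ e))

theorem IsCell.exists_eq (h : IsCell o src dst c δ q m β) :
    ∀ j < Finset.univ.sup β + 1, ∃ e, β e = j := by
  intro j hj
  obtain ⟨-, h2⟩ := (sup_univ_eq_iff β (Finset.univ.sup β)).1 rfl
  rcases h2 with h2 | ⟨e, he⟩
  · exact ⟨o, by rw [h.β_base]; omega⟩
  · rcases Nat.lt_or_ge j (β e) with hje | hje
    · exact h.surj e j hje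
    · exact ⟨e, by omega⟩

theorem IsCell.exists_max (h : IsCell o src dst c δ q m β) {T : ℕ} {x : E → ℕ}
    (hx : x ∈ ordMaps β (Finset.univ.sup β + 1) T) :
    ∃ e, x e = T ∧ β e = Finset.univ.sup β := by
  rw [mem_ordMaps] at hx
  obtain ⟨-, ⟨hT, hT'⟩, hm⟩ := hx
  obtain ⟨e, he⟩ := h.exists_eq (Finset.univ.sup β) (by omega)
  have hTe := hT e
  rcases hT' with h0 | ⟨e', he'⟩
  · exact ⟨e, by omega, he⟩
  · have hle : β e' ≤ Finset.univ.sup β := Finset.le_sup (Finset.mem_univ e')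
    rcases hle.lt_or_eq with hlt | heq
    · have := hm e' e (by omega) (by omega)
      exact ⟨e, by omega, he⟩
    · exact ⟨e', he', heq⟩

theorem IsCell.isSol_of_decodes (h : IsCell o src dst c δ q m β)
    (hq : q o = 0) (hq1 : ∀ a, q (dst a) + c a * δ = q (src a) + 1)
    {t : ℤ} {T : ℕ} (hT : 2 * (T : ℤ) + (Finset.univ.sup β + 1 : ℕ) = 2 * t + δ) {x : E → ℕ}
    (hx : x ∈ ordMaps β (Finset.univ.sup β + 1) T) {f : E → ℤ}
    (hf : Decodes o δ q t m β x f) : IsSol o src dst c t f := by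
  rw [mem_ordMaps] at hx
  obtain ⟨-, ⟨hxT, -⟩, hm⟩ := hx
  constructor
  · have := hf o
    rw [h.m_base, h.β_base, hq] at this
    simp at this
    exact this
  · intro a
    have hi := hf (src a)
    have hj := hf (dst a)
    have h1 := hq1 a
    have hxi := hxT (src a)
    have hxj := hxT (dst a)
    have hbi := IsCell.lt_sup_succ (β := β) (src a)
    have hbj := IsCell.lt_sup_succ (β := β) (dst a)
    have key : 2 * (x (src a) : ℤ) + β (src a) - (2 * x (dst a) + β (dst a))
        < (2 * t + δ) * (c a + m (src a) - m (dst a)) := by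
      rcases h.constr a with hD | ⟨hD, hβ⟩
      · have : 2 * (x (src a) : ℤ) + β (src a) < 2 * t + δ := by omega
        nlinarith
      · rw [hD, mul_zero]
        have := hm _ _ hβ hbj
        omega
    nlinarith

theorem IsCell.base_le (h : IsCell o src dst c δ q m β) {m' : E → ℤ} {β' : E → ℕ}
    (h' : IsCell o src dst c δ q m' β') {t : ℤ} {T T' : ℕ}
    (hT : 2 * (T : ℤ) + (Finset.univ.sup β + 1 : ℕ) = 2 * t + δ)
    (hT' : 2 * (T' : ℤ) + (Finset.univ.sup β' + 1 : ℕ) = 2 * t + δ) {x x' : E → ℕ}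
    (hx : x ∈ ordMaps β (Finset.univ.sup β + 1) T)
    (hx' : x' ∈ ordMaps β' (Finset.univ.sup β' + 1) T') {f : E → ℤ}
    (hf : Decodes o δ q t m β x f) (hf' : Decodes o δ q t m' β' x' f) : x' o ≤ x o := by
  obtain ⟨e, hxe, hβe⟩ := h.exists_max hx
  rw [mem_ordMaps] at hx hx'
  by_contra! hlt
  have h1 := hf e
  have h2 := hf' e
  have hxe' := hx'.2.1.1 e
  have hxo' := hx'.2.1.1 o
  have hbe' := IsCell.lt_sup_succ (β := β') e
  have hb' := IsCell.lt_sup_succ (β := β') o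
  have hN : m' e - m e + 1 = 0 := by
    refine int_eq_of_sub_eq_mul (N := 2 * t + δ) (x := 2 * x' e + β' e)
      (y := 2 * x' o - 2 * x o - 1) (by omega) (by omega) (by omega) (by omega) ?_
    have h3 : (2 * (x e : ℤ) + β e) + 1 = 2 * t + δ := by rw [hxe, hβe]; omega
    linear_combination h1 - h2 + h3
  have hG' : 2 * (x' e : ℤ) + β' e = 2 * x' o - 2 * x o - 1 := by
    have h3 : (2 * (x e : ℤ) + β e) + 1 = 2 * t + δ := by rw [hxe, hβe]; omega
    linear_combination h1 - h2 + h3 + (2 * t + δ) * hN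
  have h4 := hx'.2.2 o e (by rw [h'.β_base]; omega) hbe'
  omega

theorem IsCell.decodes_injective (h : IsCell o src dst c δ q m β) {m' : E → ℤ} {β' : E → ℕ}
    (h' : IsCell o src dst c δ q m' β') {t : ℤ} {T T' : ℕ}
    (hT : 2 * (T : ℤ) + (Finset.univ.sup β + 1 : ℕ) = 2 * t + δ)
    (hT' : 2 * (T' : ℤ) + (Finset.univ.sup β' + 1 : ℕ) = 2 * t + δ) {x x' : E → ℕ}
    (hx : x ∈ ordMaps β (Finset.univ.sup β + 1) T)
    (hx' : x' ∈ ordMaps β' (Finset.univ.sup β' + 1) T') {f : E → ℤ}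
    (hf : Decodes o δ q t m β x f) (hf' : Decodes o δ q t m' β' x' f) :
    m = m' ∧ β = β' ∧ x = x' := by
  have ho : x o = x' o :=
    le_antisymm (h'.base_le h hT' hT hx' hx hf' hf) (h.base_le h' hT hT' hx hx' hf hf')
  rw [mem_ordMaps] at hx hx'
  have hsub : ∀ e, 2 * (x e : ℤ) + β e - (2 * x' e + β' e) = (2 * t + δ) * (m e - m' e) := by
    intro e
    have := hf e
    have := hf' e
    rw [ho] at *
    linarith
  have hm0 : ∀ e, m e - m' e = 0 := by
    intro e
    have := hx.2.1.1 e
    have := hx'.2.1.1 e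
    have := IsCell.lt_sup_succ (β := β) e
    have := IsCell.lt_sup_succ (β := β') e
    exact int_eq_of_sub_eq_mul (by omega) (by omega) (by omega) (by omega) (hsub e)
  have hG : ∀ e, 2 * x e + β e = 2 * x' e + β' e := by
    intro e
    have := hsub e
    rw [hm0 e, mul_zero] at this
    omega
  have hβ : β = β' := by
    refine eq_of_alternating (G := fun e => 2 * x e + β e) (fun e => ?_) h.surj h'.surj ?_ ?_
    · have := hG e
      omega
    · intro u v huv
      have := hx.2.2 u v huv (IsCell.lt_sup_succ v)
      omega
    · intro u v huv
      have := hx'.2.2 u v huv (IsCell.lt_sup_succ v)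
      simp only [hG]
      omega
  refine ⟨funext fun e => by linarith [hm0 e], hβ, funext fun e => ?_⟩
  have := hG e
  rw [hβ] at this
  omega

/-- The number of parity changes among the elements of `S` (preceded by `0`) up to `v`. -/
noncomputable def parityBlock (S : Set ℕ) : ℕ → ℕ
  | 0 => 0
  | v + 1 => if v + 1 ∈ S ∧ (v + 1) % 2 ≠ parityBlock S v % 2
      then parityBlock S v + 1 else parityBlock S v

theorem parityBlock_step (S : Set ℕ) (v : ℕ) :
    parityBlock S v ≤ parityBlock S (v + 1) ∧ parityBlock S (v + 1) ≤ parityBlock S v + 1 := by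
  rw [parityBlock]
  split_ifs <;> omega

theorem parityBlock_mono (S : Set ℕ) : Monotone (parityBlock S) :=
  monotone_nat_of_le_succ fun v => (parityBlock_step S v).1

theorem add_parityBlock_le (S : Set ℕ) {u v : ℕ} (h : u ≤ v) :
    u + parityBlock S v ≤ v + parityBlock S u := by
  induction v, h using Nat.le_induction with
  | base => exact le_rfl
  | succ v _ ih => have := parityBlock_step S v; omega

theorem parityBlock_le (S : Set ℕ) (v : ℕ) : parityBlock S v ≤ v := by
  have := add_parityBlock_le S (Nat.zero_le v)
  simpa [parityBlock] using this

theorem parityBlock_mod_two (S : Set ℕ) {v : ℕ} (h : v ∈ S) : parityBlock S v % 2 = v % 2 := by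
  cases v with
  | zero => rfl
  | succ v =>
    rw [parityBlock]
    split_ifs with h1
    · omega
    · rw [not_and, not_not] at h1
      exact (h1 h).symm

theorem exists_parityBlock_eq (S : Set ℕ) (v i : ℕ) (hi : 1 ≤ i) (hv : i ≤ parityBlock S v) :
    ∃ w ∈ S, parityBlock S w = i := by
  induction v with
  | zero => simp [parityBlock] at hv; omega
  | succ v ih =>
    by_cases h : i ≤ parityBlock S v
    · exact ih h
    · have hstep := parityBlock_step S v
      refine ⟨v + 1, ?_, by omega⟩
      by_contra hS
      rw [parityBlock, if_neg (fun h => hS h.1)] at hv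
      exact h hv

theorem exists_isCell_decodes [Nonempty ι] (hδ : 1 ≤ δ)
    (hq : q o = 0) (hq1 : ∀ a, q (dst a) + c a * δ = q (src a) + 1)
    {κ Q : ℤ} (hκ : 0 ≤ κ) (hQ : ∀ e, |q e| ≤ Q) {t : ℕ} {f : E → ℤ}
    (hf : IsSol o src dst c t f) (hfκ : ∀ e, |f e| ≤ κ * t) :
    ∃ (m : E → ℤ) (β x : E → ℕ) (T : ℕ), IsCell o src dst c δ q m β ∧
      (∀ e, |m e| ≤ 2 + κ + Q) ∧ 2 * (T : ℤ) + (Finset.univ.sup β + 1 : ℕ) = 2 * t + δ ∧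
      x ∈ ordMaps β (Finset.univ.sup β + 1) T ∧ Decodes o δ q t m β x f := by
  obtain ⟨N, hNdef⟩ : ∃ N : ℤ, N = 2 * t + δ := ⟨_, rfl⟩
  have hN : 0 < N := by omega
  obtain ⟨F, hF⟩ : ∃ F : E → ℤ, ∀ e, F e = 2 * f e + q e := ⟨_, fun _ => rfl⟩
  have hFo : F o = 0 := by rw [hF, hf.1, hq]; rfl
  have hodd : ∃ e, Odd (F e) ∨ Odd N := by
    obtain ⟨a⟩ := ‹Nonempty ι›
    rcases Int.even_or_odd N with hev | hod
    · have h1 := hq1 a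
      have h2 : Even (δ : ℤ) := by
        rw [hNdef] at hev
        exact (Int.even_add.1 hev).1 (even_two_mul _)
      obtain ⟨k, hk⟩ := h2.mul_left (c a)
      rw [hk] at h1
      rcases Int.even_or_odd' (q (src a)) with ⟨k', hk' | hk'⟩
      · exact ⟨dst a, Or.inl ⟨f (dst a) + k' - k, by rw [hF]; linarith⟩⟩
      · exact ⟨src a, Or.inl ⟨f (src a) + k', by rw [hF]; linarith⟩⟩
    · exact ⟨o, Or.inr hod⟩
  obtain ⟨M, hM1, hM0, ⟨M', hM'⟩, ⟨u, ju, hu⟩, hmax⟩ := exists_greatest_odd_lift hN hFo hodd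
  obtain ⟨m, hm⟩ : ∃ m : E → ℤ, ∀ e, m e = -((F e - M - 1) / N) := ⟨_, fun _ => rfl⟩
  obtain ⟨g, hg⟩ : ∃ g : E → ℕ, ∀ e, (g e : ℤ) = (F e - M - 1) % N :=
    ⟨fun e => ((F e - M - 1) % N).toNat, fun e => Int.toNat_of_nonneg (Int.emod_nonneg _ hN.ne')⟩
  have hgN : ∀ e, (g e : ℤ) < N := fun e => by rw [hg]; exact Int.emod_lt_of_pos _ hN
  have hFg : ∀ e, F e = M + 1 + g e - N * m e := fun e => by
    have := Int.mul_ediv_add_emod (F e - M - 1) N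
    rw [hg, hm]
    linarith
  have huniq : ∀ e (v k : ℤ), 0 ≤ v → v < N → F e - M - 1 = v + N * k → g e = v ∧ m e = -k := by
    intro e v k h0 h1 h2
    have h3 := hFg e
    have h4 : -m e - k = 0 := int_eq_of_sub_eq_mul (N := N) (x := v) (y := g e) h0 h1
      (Int.natCast_nonneg _) (hgN e) (by linarith) 
    refine ⟨?_, by omega⟩
    have h5 : m e = -k := by omega
    rw [h5] at h3
    linarith
  obtain ⟨hgo, hmo⟩ := huniq o (-M - 1) 0 (by omega) (by omega) (by rw [hFo]; ring)
  obtain ⟨hgu, -⟩ := huniq u (N - 1) (-ju - 1) (by omega) (by omega) (by rw [hu]; ring)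
  set S : Set ℕ := Set.range g with hS
  have hmem : ∀ e, g e ∈ S := fun e => ⟨e, rfl⟩
  obtain ⟨β, hβ⟩ : ∃ β : E → ℕ, ∀ e, β e = parityBlock S (g e) := ⟨_, fun _ => rfl⟩
  have hβ2 : ∀ e, β e % 2 = g e % 2 := fun e => by rw [hβ]; exact parityBlock_mod_two S (hmem e)
  have hβle : ∀ e, β e ≤ g e := fun e => by rw [hβ]; exact parityBlock_le S _
  have hβmono : ∀ e e', g e ≤ g e' → β e ≤ β e' := fun e e' h => by
    rw [hβ, hβ]; exact parityBlock_mono S h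
  have hβadd : ∀ e e', g e ≤ g e' → g e + β e' ≤ g e' + β e := fun e e' h => by
    rw [hβ, hβ]; exact add_parityBlock_le S h
  have hβlt : ∀ e e', β e < β e' → g e < g e' := fun e e' h => by
    by_contra! h'
    have := hβmono e' e h'
    omega
  have hβex : ∀ e i, 1 ≤ i → i ≤ β e → ∃ e', β e' = i := fun e i h1 h2 => by
    rw [hβ] at h2
    obtain ⟨w, ⟨e', rfl⟩, hw⟩ := exists_parityBlock_eq S (g e) i h1 h2
    exact ⟨e', by rw [hβ, hw]⟩
  have hβo : β o = 0 := by
    by_contra hne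
    obtain ⟨e, he⟩ := hβex o 1 le_rfl (by omega)
    have h1 := hβ2 e
    have h2 := hβ2 o
    have h3 := hβlt e o (by omega)
    have := hmax (M + 1 + g e) (by omega) ⟨(M + g e) / 2, by omega⟩
      ⟨e, m e, by rw [hFg]; ring⟩
    omega
  obtain ⟨x, hx⟩ : ∃ x : E → ℕ, ∀ e, 2 * x e + β e = g e :=
    ⟨fun e => (g e - β e) / 2, fun e => by have := hβ2 e; have := hβle e; dsimp only; omega⟩
  have hβu : Finset.univ.sup β = β u := by
    refine le_antisymm (Finset.sup_le fun e _ => hβmono e u ?_) (Finset.le_sup (Finset.mem_univ u))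
    have := hgN e
    omega
  refine ⟨m, β, x, x u, ⟨by rw [hmo]; rfl, hβo, ?_, ?_, ?_⟩, ?_, ?_, ?_, ?_⟩
  · intro e i hi
    rcases Nat.eq_zero_or_pos i with rfl | h1
    · exact ⟨o, hβo⟩
    · exact hβex e i h1 hi.le
  · intro e
    refine ⟨M' + 1 + x e - f e - t * m e, ?_⟩
    have h1 := hFg e
    have h2 : (2 * x e + β e : ℤ) = g e := by exact_mod_cast hx e
    rw [hF, ← h2, hM', hNdef] at h1
    linear_combination h1
  · intro a
    have h1 := hf.2 a
    have h2 := hFg (src a)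
    have h3 := hFg (dst a)
    rw [hF] at h2 h3
    have h4 := hq1 a
    have h5 := hgN (src a)
    have h6 := hgN (dst a)
    have h7 : (g (src a) : ℤ) - g (dst a) + 1 ≤ N * (c a + m (src a) - m (dst a)) := by
      rw [hNdef] at *
      nlinarith
    rcases lt_trichotomy (c a + m (src a) - m (dst a)) 0 with hD | hD | hD
    · nlinarith
    · right
      refine ⟨hD, ?_⟩
      rw [hD, mul_zero] at h7
      have h8 : β (src a) ≤ β (dst a) := hβmono _ _ (by omega)
      have h9 := hβ2 (src a)
      have h10 := hβ2 (dst a)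
      have h11 : (g (src a) : ℤ) - g (dst a) + 1
          = 2 * (f (src a) - f (dst a) - c a * t) + N * (c a + m (src a) - m (dst a)) := by
        rw [hNdef] at *
        linear_combination h3 - h2 - h4 
      rw [hD, mul_zero] at h11
      omega
    · exact Or.inl hD
  · intro e
    have h1 := hFg e
    rw [hF] at h1
    have h2 := abs_le.1 (hfκ e)
    have h3 := abs_le.1 (hQ e)
    have h4 := hgN e
    have h5 : N * m e ≤ N * (2 + κ + Q) := by nlinarith
    have h6 : N * (-(2 + κ + Q)) ≤ N * m e := by nlinarith
    exact abs_le.2 ⟨le_of_mul_le_mul_left h6 hN, le_of_mul_le_mul_left h5 hN⟩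
  · have := hx u
    rw [hβu]
    push_cast
    omega
  · rw [mem_ordMaps]
    refine ⟨fun e he => ?_, ⟨fun e => ?_, Or.inr ⟨u, rfl⟩⟩, fun e e' h _ => ?_⟩
    · have := IsCell.lt_sup_succ (β := β) e
      omega
    · have := hgN e
      have := hβadd e u (by omega)
      have := hx e
      have := hx u
      omega
    · have := hβadd e e' (hβlt e e' h).le
      have := hx e
      have := hx e'
      omega
  · intro e
    have h1 := hFg e
    have h2 := hx e
    have h3 := hx o
    rw [hβo] at h3
    rw [← hF, h1, hNdef]
    have h4 : (2 * x e + β e : ℤ) = g e := by exact_mod_cast h2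
    have h5 : (2 * x o : ℤ) = g o := by exact_mod_cast h3
    rw [← hNdef]
    linarith

theorem IsCell.sup_succ_le_card (h : IsCell o src dst c δ q m β) :
    Finset.univ.sup β + 1 ≤ Fintype.card E := by
  have hsub : Finset.range (Finset.univ.sup β + 1) ⊆ Finset.univ.image β := by
    intro j hj
    obtain ⟨e, he⟩ := h.exists_eq j (Finset.mem_range.1 hj)
    exact Finset.mem_image.2 ⟨e, Finset.mem_univ _, he⟩
  have h1 := (Finset.card_le_card hsub).trans Finset.card_image_le
  simpa using h1

theorem IsCell.le_sup_succ (hE : 2 ≤ Fintype.card E) (hq : q o = 0)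
    (hq1 : ∀ a, q (dst a) + c a * δ = q (src a) + 1)
    (h0 : ∀ f, IsSol o src dst c 0 f → f = 0) (h : IsCell o src dst c δ q m β)
    (hpar : (2 : ℤ) ∣ (Finset.univ.sup β + 1 : ℕ) - δ) : δ ≤ Finset.univ.sup β + 1 := by
  by_contra! hlt
  obtain ⟨T, hT⟩ : ∃ T : ℕ, 2 * (T : ℤ) + (Finset.univ.sup β + 1 : ℕ) = 2 * 0 + δ :=
    ⟨(δ - (Finset.univ.sup β + 1)) / 2, by omega⟩
  obtain ⟨u, hu⟩ := h.exists_eq (Finset.univ.sup β) (by omega)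
  have hconst : (fun _ => T) ∈ ordMaps β (Finset.univ.sup β + 1) T := by
    rw [mem_ordMaps]
    refine ⟨fun e he => ?_, ⟨fun _ => le_rfl, Or.inr ⟨o, rfl⟩⟩, fun _ _ _ _ => le_rfl⟩
    have := IsCell.lt_sup_succ (β := β) e
    omega
  have hsingle : Pi.single u T ∈ ordMaps β (Finset.univ.sup β + 1) T := by
    rw [mem_ordMaps]
    refine ⟨fun e he => ?_, ⟨fun e => ?_, Or.inr ⟨u, Pi.single_eq_same _ _⟩⟩,
      fun e e' h1 h2 => ?_⟩
    · have := IsCell.lt_sup_succ (β := β) e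
      omega
    · by_cases heu : e = u
      · rw [heu, Pi.single_eq_same]
      · rw [Pi.single_eq_of_ne heu]
        exact Nat.zero_le _
    · have heu : e ≠ u := by
        rintro rfl
        omega
      rw [Pi.single_eq_of_ne heu]
      exact Nat.zero_le _
  obtain ⟨f, hf⟩ := h.exists_decodes 0 (fun _ => T)
  obtain ⟨f', hf'⟩ := h.exists_decodes 0 (Pi.single u T)
  have hf0 := h0 f (h.isSol_of_decodes hq hq1 hT hconst hf)
  have hf0' := h0 f' (h.isSol_of_decodes hq hq1 hT hsingle hf')
  subst hf0
  subst hf0'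
  obtain ⟨-, -, hx⟩ := h.decodes_injective h hT hT hconst hsingle hf hf'
  have : Nontrivial E := Fintype.one_lt_card_iff_nontrivial.1 hE
  obtain ⟨e, he⟩ := exists_ne u
  have h1 := congrFun hx e
  rw [Pi.single_eq_of_ne he] at h1
  omega

/-- The finitely many cells, with `m` bounded by `K`, that encode solutions. -/
noncomputable def cells (o : E) (src dst : ι → E) (c : ι → ℤ) (δ : ℕ) (q : E → ℤ) (K : ℤ) :
    Finset ((E → ℤ) × (E → ℕ)) :=
  ((Fintype.piFinset fun _ => Finset.Icc (-K) K) ×ˢ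
    (Fintype.piFinset fun _ => Finset.range (Fintype.card E))).filter fun p =>
      IsCell o src dst c δ q p.1 p.2 ∧ δ ≤ Finset.univ.sup p.2 + 1 ∧
        (2 : ℤ) ∣ (Finset.univ.sup p.2 + 1 : ℕ) - δ

/-- The points of the cells that encode solutions at level `t`. -/
noncomputable def cellPoints (δ t : ℕ) (β : E → ℕ) : Finset (E → ℕ) :=
  if (Finset.univ.sup β + 1 - δ) / 2 ≤ t then
    ordMaps β (Finset.univ.sup β + 1) (t - (Finset.univ.sup β + 1 - δ) / 2) else ∅

theorem ncard_isSol [Nonempty ι] (hE : 2 ≤ Fintype.card E) (hδ : 1 ≤ δ) (hq : q o = 0)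
    (hq1 : ∀ a, q (dst a) + c a * δ = q (src a) + 1) {κ Q : ℤ} (hκ : 0 ≤ κ)
    (hQ : ∀ e, |q e| ≤ Q)
    (hbd : ∀ (t : ℕ) f, IsSol o src dst c t f → ∀ e, |f e| ≤ κ * t) (t : ℕ) :
    Set.ncard {f | IsSol o src dst c t f} =
      ∑ p ∈ cells o src dst c δ q (2 + κ + Q), (cellPoints δ t p.2).card := by
  obtain ⟨dec, hdec⟩ : ∃ dec : ((_ : (E → ℤ) × (E → ℕ)) × (E → ℕ)) → E → ℤ,
      ∀ p, IsCell o src dst c δ q p.1.1 p.1.2 → Decodes o δ q t p.1.1 p.1.2 p.2 (dec p) :=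
    ⟨fun p => if h : IsCell o src dst c δ q p.1.1 p.1.2 then
      (h.exists_decodes t p.2).choose else 0, fun p h => by
        dsimp only
        rw [dif_pos h]
        exact (h.exists_decodes t p.2).choose_spec⟩
  have h0 : ∀ f, IsSol o src dst c 0 f → f = 0 := fun f hf => funext fun e => by
    have := hbd 0 f hf e
    simpa using this
  set A : Finset ((_ : (E → ℤ) × (E → ℕ)) × (E → ℕ)) :=
    (cells o src dst c δ q (2 + κ + Q)).sigma fun p => cellPoints δ t p.2 with hA
  have hmemA : ∀ p ∈ A, IsCell o src dst c δ q p.1.1 p.1.2 ∧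
      ∃ T : ℕ, 2 * (T : ℤ) + (Finset.univ.sup p.1.2 + 1 : ℕ) = 2 * (t : ℤ) + δ ∧
        p.2 ∈ ordMaps p.1.2 (Finset.univ.sup p.1.2 + 1) T := by
    intro p hp
    rw [hA, Finset.mem_sigma, cells, Finset.mem_filter] at hp
    obtain ⟨⟨-, h1, h2, h3⟩, h4⟩ := hp
    rw [cellPoints] at h4
    split_ifs at h4 with h5
    · exact ⟨h1, _, by omega, h4⟩
    · simp at h4
  have himage : {f | IsSol o src dst c t f} = ↑(A.image dec) := by
    ext f
    rw [Finset.mem_coe, Finset.mem_image]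
    constructor
    · intro hf
      obtain ⟨m, β, x, T, hcell, hm, hT, hx, hd⟩ :=
        exists_isCell_decodes hδ hq hq1 hκ hQ hf (hbd t f hf)
      have hdvd : (2 : ℤ) ∣ (Finset.univ.sup β + 1 : ℕ) - δ := ⟨t - T, by linarith⟩
      have hle := hcell.le_sup_succ hE hq hq1 h0 hdvd
      refine ⟨⟨(m, β), x⟩, ?_, ?_⟩
      · rw [hA, Finset.mem_sigma, cells, Finset.mem_filter, Finset.mem_product,
          Fintype.mem_piFinset, Fintype.mem_piFinset]
        refine ⟨⟨⟨fun e => Finset.mem_Icc.2 (abs_le.1 (hm e)), fun e => Finset.mem_range.2 ?_⟩,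
          hcell, hle, hdvd⟩, ?_⟩
        · have h1 := hcell.sup_succ_le_card
          have h2 := IsCell.lt_sup_succ (β := β) e
          dsimp only
          omega
        · have h3 : (Finset.univ.sup β + 1 - δ) / 2 + T = t := by omega
          dsimp only
          rw [cellPoints, if_pos (by omega)]
          have h4 : t - (Finset.univ.sup β + 1 - δ) / 2 = T := by omega
          rw [h4]
          exact hx
      · have hd' := hdec ⟨(m, β), x⟩ hcell
        funext e
        have h1 := hd e
        have h2 := hd' e
        dsimp only at h2
        linarith
    · rintro ⟨p, hp, rfl⟩
      obtain ⟨hcell, T, hT, hx⟩ := hmemA p hp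
      exact hcell.isSol_of_decodes hq hq1 hT hx (hdec p hcell)
  have hinj : Set.InjOn dec A := by
    intro p hp p' hp' hpp
    obtain ⟨hcell, T, hT, hx⟩ := hmemA p hp
    obtain ⟨hcell', T', hT', hx'⟩ := hmemA p' hp'
    have hd := hdec p hcell
    rw [hpp] at hd
    obtain ⟨h1, h2, h3⟩ := hcell.decodes_injective hcell' hT hT' hx hx' hd (hdec p' hcell')
    obtain ⟨⟨m, β⟩, x⟩ := p
    obtain ⟨⟨m', β'⟩, x'⟩ := p'
    dsimp only at h1 h2 h3
    rw [h1, h2, h3]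
  rw [himage, Set.ncard_coe_finset, Finset.card_image_of_injOn hinj, Finset.card_sigma]

open PowerSeries in
theorem one_sub_pow_mul_mk_ncard_isSol_mem [Nonempty ι] (hE : 2 ≤ Fintype.card E) (hδ : 1 ≤ δ)
    (hq : q o = 0) (hq1 : ∀ a, q (dst a) + c a * δ = q (src a) + 1) {κ : ℤ} (hκ : 0 ≤ κ)
    (hbd : ∀ (t : ℕ) f, IsSol o src dst c t f → ∀ e, |f e| ≤ κ * t) :
    (1 - X) ^ Fintype.card E *
      PowerSeries.mk (fun t : ℕ => (Set.ncard {f | IsSol o src dst c t f} : ℤ)) ∈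
        gammaCone (Fintype.card E - δ) := by
  have hQ : ∀ e, |q e| ≤ ∑ e, |q e| := fun e =>
    Finset.single_le_sum (f := fun e => |q e|) (fun e _ => abs_nonneg _) (Finset.mem_univ e)
  set C := cells o src dst c δ q (2 + κ + ∑ e, |q e|) with hC
  have hmk : PowerSeries.mk (fun t : ℕ => (Set.ncard {f | IsSol o src dst c t f} : ℤ)) =
      ∑ p ∈ C, X ^ ((Finset.univ.sup p.2 + 1 - δ) / 2) *
        PowerSeries.mk fun T => ((ordMaps p.2 (Finset.univ.sup p.2 + 1) T).card : ℤ) := by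
    ext t
    rw [coeff_mk, ncard_isSol hE hδ hq hq1 hκ hQ hbd, map_sum, Nat.cast_sum]
    refine Finset.sum_congr rfl fun p _ => ?_
    rw [coeff_X_pow_mul', cellPoints]
    split_ifs
    · rw [coeff_mk]
    · simp
  rw [hmk, Finset.mul_sum]
  refine AddSubmonoid.sum_mem _ fun p hp => ?_
  rw [hC, cells, Finset.mem_filter] at hp
  obtain ⟨-, h1, h2, h3⟩ := hp
  have h4 := one_sub_pow_mul_mk_card_ordMaps p.2 (Finset.univ.sup p.2 + 1) h1.exists_eq
    (IsCell.lt_sup_succ)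
  have h5 : X ^ ((Finset.univ.sup p.2 + 1 - δ) / 2) ∈
      gammaCone (2 * ((Finset.univ.sup p.2 + 1 - δ) / 2)) := by
    have := gammaCone_basis_mem (c := 2 * ((Finset.univ.sup p.2 + 1 - δ) / 2))
      (j := (Finset.univ.sup p.2 + 1 - δ) / 2) (m := 0) (by omega)
    simpa using this
  have h6 := gammaCone_mul_mem h5 h4
  have h7 := h1.sup_succ_le_card
  have h8 : 2 * ((Finset.univ.sup p.2 + 1 - δ) / 2) + 
      (Fintype.card E - (Finset.univ.sup p.2 + 1)) = Fintype.card E - δ := by omega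
  rw [h8] at h6
  convert h6 using 1
  ring

end Cells

section HStar

open PowerSeries

theorem one_sub_pow_mul_mk_eq_mk {d : ℕ} {L h : ℕ → ℕ}
    (hL : ∀ t, L t = ∑ k ∈ Finset.range (d + 1), h k * (t + d - k).choose d)
    (hh : ∀ k, d < k → h k = 0) :
    (1 - X) ^ (d + 1) * PowerSeries.mk (fun t => (L t : ℤ)) = PowerSeries.mk fun k => (h k : ℤ) := by
  have h1 : PowerSeries.mk (fun t => (L t : ℤ)) = (∑ k ∈ Finset.range (d + 1),
      (C (h k : ℤ) * X ^ k)) * PowerSeries.mk fun n => ((d + n).choose d : ℤ) := by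
    ext t
    rw [coeff_mk, hL, Finset.sum_mul, map_sum, Nat.cast_sum]
    refine Finset.sum_congr rfl fun k hk => ?_
    rw [Finset.mem_range] at hk
    rw [mul_assoc, coeff_C_mul, coeff_X_pow_mul', Nat.cast_mul]
    split_ifs with hkt
    · rw [coeff_mk, show d + (t - k) = t + d - k by omega]
    · rw [Nat.choose_eq_zero_of_lt (by omega), Nat.cast_zero]
  have h2 := PowerSeries.mk_add_choose_mul_one_sub_pow_eq_one ℤ d
  rw [h1, mul_comm, mul_assoc, h2, mul_one]
  ext k
  rw [coeff_mk, map_sum]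
  simp only [coeff_C_mul, coeff_X_pow, mul_ite, mul_one, mul_zero]
  rw [Finset.sum_ite_eq]
  split_ifs with hk
  · rfl
  · rw [Finset.mem_range] at hk
    rw [hh k (by omega), Nat.cast_zero]

theorem exists_unimodal_of_mem_gammaCone {h : ℕ → ℕ} {c : ℕ}
    (hc : (PowerSeries.mk fun k => (h k : ℤ)) ∈ gammaCone c) :
    ∃ t : ℕ, (∀ i j : ℕ, i ≤ j → j ≤ t → h i ≤ h j) ∧
      (∀ i j : ℕ, t ≤ i → i ≤ j → h j ≤ h i) := by
  have h1 : ∀ k, 2 * k + 1 ≤ c → h k ≤ h (k + 1) := fun k hk => by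
    have := coeff_le_succ_of_mem_gammaCone hc hk
    simpa using this
  have h2 : ∀ k, c ≤ 2 * k + 1 → h (k + 1) ≤ h k := fun k hk => by
    have := coeff_succ_le_of_mem_gammaCone hc hk
    simpa using this
  refine ⟨c / 2, fun i j hij hj => ?_, fun i j hi hij => ?_⟩
  · induction j, hij using Nat.le_induction with
    | base => exact le_rfl
    | succ j _ ih => exact (ih (by omega)).trans (h1 j (by omega))
  · induction j, hij using Nat.le_induction with
    | base => exact le_rfl
    | succ j _ ih => exact (h2 j (by omega)).trans ih

end HStar

section Facets

variable {E ι : Type*} {o : E} {src dst : ι → E} {c : ι → ℤ} {δ : ℕ} {q : E → ℤ}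

/-- Normalized integer points at level `t` satisfying all difference constraints strictly. -/
def IsStrictSol (o : E) (src dst : ι → E) (c : ι → ℤ) (t : ℤ) (f : E → ℤ) : Prop :=
  f o = 0 ∧ ∀ a, f (src a) < f (dst a) + c a * t

theorem finite_setOf_isSol [Finite E] {κ : ℤ}
    (hbd : ∀ (t : ℕ) f, IsSol o src dst c t f → ∀ e, |f e| ≤ κ * t) (t : ℕ) :
    {f | IsSol o src dst c t f}.Finite := by
  refine (Set.Finite.pi' fun _ : E => Set.finite_Icc (-(κ * t)) (κ * t)).subset ?_
  intro f hf e
  exact abs_le.1 (hbd t f hf e)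

theorem exists_isStrictSol_of_ncard_eq [Finite E] {κ : ℤ}
    (hbd : ∀ (t : ℕ) f, IsSol o src dst c t f → ∀ e, |f e| ≤ κ * t)
    (hcard : ∀ t : ℕ, Set.ncard {f | IsStrictSol o src dst c (δ + t : ℕ) f} =
      Set.ncard {f | IsSol o src dst c t f}) :
    ∃ q, IsStrictSol o src dst c δ q ∧
      ∀ (t : ℕ) y, IsStrictSol o src dst c (δ + t : ℕ) y → IsSol o src dst c t (y - q) := by
  have h0 : {f | IsSol o src dst c (0 : ℕ) f} = {0} := by
    ext f
    constructor
    · intro hf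
      refine funext fun e => ?_
      have := hbd 0 f hf e
      simpa using this
    · rintro rfl
      exact ⟨rfl, fun a => by simp⟩
  obtain ⟨q, hq⟩ : {f | IsStrictSol o src dst c (δ + 0 : ℕ) f}.Nonempty := by
    apply Set.nonempty_of_ncard_ne_zero
    rw [hcard 0, h0, Set.ncard_singleton]
    exact one_ne_zero
  refine ⟨q, by simpa using hq, fun t y hy => ?_⟩
  have hsub : (fun f => f + q) '' {f | IsSol o src dst c t f} ⊆
      {f | IsStrictSol o src dst c (δ + t : ℕ) f} := by
    rintro _ ⟨f, hf, rfl⟩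
    refine ⟨by simp [hf.1, hq.1], fun a => ?_⟩
    have h1 := hf.2 a
    have h2 := hq.2 a
    push_cast at h2 ⊢
    simp only [Pi.add_apply]
    linarith
  have hfin : {f | IsStrictSol o src dst c (δ + t : ℕ) f}.Finite :=
    (finite_setOf_isSol hbd (δ + t)).subset fun f hf => ⟨hf.1, fun a => (hf.2 a).le⟩
  have heq := Set.eq_of_subset_of_ncard_le hsub (by
    rw [hcard t, Set.ncard_image_of_injective _ (add_left_injective q)]) hfin
  have hy' : y ∈ (fun f => f + q) '' {f | IsSol o src dst c t f} := by
    rw [heq]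
    exact hy
  obtain ⟨f, hf, rfl⟩ := hy'
  simpa using hf

/-- A feasible system `v (src a) < v (dst a)` has a solution with one of its gaps equal to `1`. -/
theorem exists_tight_potential [Fintype E] {Z : Set ι} (hZ : Z.Nonempty)
    (hfeas : ∃ w : E → ℤ, ∀ a ∈ Z, w (src a) < w (dst a)) :
    ∃ v : E → ℕ, (∀ a ∈ Z, v (src a) < v (dst a)) ∧ ∃ a ∈ Z, v (dst a) = v (src a) + 1 := by
  have hne : ∃ s, ∃ v : E → ℕ, (∀ a ∈ Z, v (src a) < v (dst a)) ∧ ∑ e, v e = s := by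
    obtain ⟨w, hw⟩ := hfeas
    refine ⟨_, fun e => (w e + ∑ e', |w e'|).toNat, fun a ha => ?_, rfl⟩
    have h1 := hw a ha
    have h2 := Finset.single_le_sum (f := fun e => |w e|) (fun e _ => abs_nonneg _)
      (Finset.mem_univ (src a))
    have h3 := neg_abs_le (w (src a))
    dsimp only at h2 ⊢
    omega
  obtain ⟨v, hv, hsum⟩ := Nat.find_spec hne
  refine ⟨v, hv, ?_⟩
  by_contra! hgap
  obtain ⟨a₀, ha₀⟩ := hZ
  have hv₀ := hv a₀ ha₀
  have hmin := Nat.find_min hne (m := ∑ e, Function.update v (dst a₀) (v (dst a₀) - 1) e) (by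
    rw [← hsum]
    refine Finset.sum_lt_sum (fun e _ => ?_) ⟨dst a₀, Finset.mem_univ _, ?_⟩
    · by_cases he : e = dst a₀
      · rw [he, Function.update_self]
        omega
      · rw [Function.update_of_ne he]
    · rw [Function.update_self]
      omega)
  refine hmin ⟨_, fun a ha => ?_, rfl⟩
  have h1 := hv a ha
  have h2 := hgap a ha
  rw [Function.update_apply, Function.update_apply]
  split_ifs with h3 h4 h4
  · rw [h3, h4] at h1
    omega
  · rw [h3] at h1 
    omega
  · rw [h4] at h1 h2
    omega
  · exact h1

theorem isSol_of_facets [Fintype E] [Fintype ι] (hδ : 1 ≤ δ) (hq : IsStrictSol o src dst c δ q)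
    (hqG : ∀ (t : ℕ) y, IsStrictSol o src dst c (δ + t : ℕ) y → IsSol o src dst c t (y - q))
    {t : ℕ} {p : E → ℤ} (hp0 : p o = 0)
    (hp : ∀ a, q (dst a) + c a * δ = q (src a) + 1 → p (src a) ≤ p (dst a) + c a * t) :
    IsSol o src dst c t p := by
  have hex : ∃ N : ℕ, IsSol o src dst c (t + N * δ : ℕ) fun e => p e + N * q e := by
    obtain ⟨N, hN⟩ : ∃ N : ℕ, ∀ a, p (src a) - p (dst a) - c a * t ≤ N := by
      refine ⟨(∑ a, |p (src a) - p (dst a) - c a * t|).toNat, fun a => ?_⟩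
      have h2 := Finset.single_le_sum (f := fun a => |p (src a) - p (dst a) - c a * t|)
        (fun e _ => abs_nonneg _) (Finset.mem_univ a)
      exact (le_abs_self _).trans (h2.trans (Int.self_le_toNat _))
    refine ⟨N, by simp [hp0, hq.1], fun a => ?_⟩
    have h1 := hN a
    have h2 := hq.2 a
    push_cast
    nlinarith
  obtain ⟨N, hN⟩ : ∃ N, N = Nat.find hex := ⟨_, rfl⟩
  have hy := Nat.find_spec hex
  rw [← hN] at hy
  rcases Nat.eq_zero_or_pos N with h0 | hpos
  · rw [h0] at hy
    simpa using hy
  exfalso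
  obtain ⟨y, hyapp⟩ : ∃ y : E → ℤ, ∀ e, y e = p e + N * q e := ⟨_, fun _ => rfl⟩
  simp only [← hyapp] at hy
  obtain ⟨τ, hτ⟩ : ∃ τ, τ = t + N * δ := ⟨_, rfl⟩
  have hτδ : δ ≤ τ := by nlinarith
  rw [← hτ] at hy
  set Z : Set ι := {a | y (src a) = y (dst a) + c a * τ} with hZdef
  have hZ : Z.Nonempty := by
    by_contra hemp
    rw [Set.not_nonempty_iff_eq_empty] at hemp
    have hstrict : IsStrictSol o src dst c (δ + (τ - δ) : ℕ) y := by
      refine ⟨hy.1, fun a => ?_⟩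
      rw [Nat.add_sub_cancel' hτδ]
      refine lt_of_le_of_ne (hy.2 a) fun h => ?_
      have : a ∈ Z := h
      rw [hemp] at this
      exact this
    have hsol := hqG _ _ hstrict
    refine Nat.find_min hex (m := N - 1) (by omega) ?_
    have h1 : t + (N - 1) * δ = τ - δ := by
      rw [hτ, Nat.sub_mul, one_mul]
      have : δ ≤ N * δ := by nlinarith
      omega
    have h2 : (fun e => p e + (N - 1 : ℕ) * q e) = y - q := by
      funext e
      have : (N : ℤ) = (N - 1 : ℕ) + 1 := by omega
      rw [Pi.sub_apply, hyapp, this]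
      ring
    rw [h1, h2]
    exact hsol
  have hZq : ∀ a ∈ Z, q (src a) + 2 ≤ q (dst a) + c a * δ := by
    intro a ha
    have h1 := hq.2 a
    by_contra! hlt
    have h2 := hp a (by omega)
    have h3 : y (src a) = y (dst a) + c a * τ := ha
    rw [hyapp, hyapp, hτ] at h3
    push_cast at h3
    have h4 : (1 : ℤ) ≤ N := by exact_mod_cast hpos
    nlinarith
  have hτ1 : (1 : ℤ) ≤ τ := by exact_mod_cast hδ.trans hτδ
  obtain ⟨v, hv, a, ha, hva⟩ := exists_tight_potential (src := src) (dst := dst) hZ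
    ⟨fun e => τ * q e - δ * y e, fun a ha => by
      have h1 := hZq a ha
      have h3 : y (src a) = y (dst a) + c a * τ := ha
      dsimp only
      rw [h3]
      nlinarith⟩
  obtain ⟨R, hR⟩ : ∃ R, R = ∑ e, v e + 1 := ⟨_, rfl⟩
  have hvR : ∀ e, v e < R := fun e => by
    have := Finset.single_le_sum (f := v) (fun e _ => Nat.zero_le _) (Finset.mem_univ e)
    omega
  have hRτ : δ ≤ R * τ := hτδ.trans (Nat.le_mul_of_pos_left _ (by omega))
  have hw : IsStrictSol o src dst c (δ + (R * τ - δ) : ℕ) fun e => R * y e + v e - v o := by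
    refine ⟨by simp [hy.1], fun a => ?_⟩
    rw [Nat.add_sub_cancel' hRτ]
    push_cast
    by_cases haZ : a ∈ Z
    · have h1 := hv a haZ
      have h3 : y (src a) = y (dst a) + c a * τ := haZ
      rw [h3]
      zify at h1
      nlinarith
    · have h1 : y (src a) < y (dst a) + c a * τ := lt_of_le_of_ne (hy.2 a) haZ
      have h2 := hvR (src a)
      zify at h2
      have h3 : (R : ℤ) * (y (src a) + 1) ≤ R * (y (dst a) + c a * τ) :=
        mul_le_mul_of_nonneg_left h1 (Int.natCast_nonneg _)
      nlinarith
  have h1 := (hqG _ _ hw).2 a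
  have h2 := hZq a ha
  have h3 : y (src a) = y (dst a) + c a * τ := ha
  simp only [Pi.sub_apply] at h1
  rw [Nat.cast_sub hRτ, h3, hva] at h1
  push_cast at h1
  nlinarith


open PowerSeries in
theorem exists_gammaCone_of_ncard_eq [Fintype E] [Fintype ι] (hE : 2 ≤ Fintype.card E)
    (hδ : 1 ≤ δ) {κ : ℤ} (hκ : 0 ≤ κ)
    (hbd : ∀ (t : ℕ) f, IsSol o src dst c t f → ∀ e, |f e| ≤ κ * t)
    (hcard : ∀ t : ℕ, Set.ncard {f | IsStrictSol o src dst c (δ + t : ℕ) f} =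
      Set.ncard {f | IsSol o src dst c t f}) :
    ∃ k, (1 - X) ^ Fintype.card E *
      PowerSeries.mk (fun t : ℕ => (Set.ncard {f | IsSol o src dst c t f} : ℤ)) ∈ gammaCone k := by
  obtain ⟨q, hq, hqG⟩ := exists_isStrictSol_of_ncard_eq hbd hcard
  set ι' := {a // q (dst a) + c a * δ = q (src a) + 1}
  have hsol : ∀ (t : ℕ) f, IsSol o (fun a : ι' => src a) (fun a => dst a) (fun a => c a) t f ↔
      IsSol o src dst c t f := fun t f =>
    ⟨fun hf => isSol_of_facets hδ hq hqG hf.1 fun a ha => hf.2 ⟨a, ha⟩,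
      fun hf => ⟨hf.1, fun a => hf.2 a⟩⟩
  have : Nonempty ι' := by
    by_contra hemp
    rw [not_nonempty_iff] at hemp
    have : Nontrivial E := Fintype.one_lt_card_iff_nontrivial.1 hE
    obtain ⟨e, he⟩ := exists_ne o
    have h1 := hbd 0 (Pi.single e 1) ((hsol 0 _).1 ⟨Pi.single_eq_of_ne he.symm _, fun a =>
      (hemp.false a).elim⟩) e
    rw [Pi.single_eq_same] at h1
    simp at h1
  refine ⟨Fintype.card E - δ, ?_⟩
  have h1 := one_sub_pow_mul_mk_ncard_isSol_mem (src := fun a : ι' => src a)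
    (dst := fun a => dst a) (c := fun a => c a) hE hδ hq.1 (fun a => a.2) hκ
    (fun t f hf => hbd t f ((hsol t f).1 hf))
  simpa only [hsol] using h1

end Facets

section PathSums

variable {R : Type*}

/-- The sum of the first `i` coordinates. -/
def psum [AddCommMonoid R] (x : Fin n → R) (i : ℕ) : R :=
  ∑ j ∈ Finset.univ.filter (fun j : Fin n => j.val < i), x j

theorem psum_zero [AddCommMonoid R] (x : Fin n → R) : psum x 0 = 0 := by
  simp [psum]

theorem psum_succ [AddCommMonoid R] (x : Fin n → R) (j : Fin n) :
    psum x (j + 1) = psum x j + x j := by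
  have : Finset.univ.filter (fun i : Fin n => i.val < j + 1) =
      insert j (Finset.univ.filter fun i : Fin n => i.val < j) := by
    ext i
    simp only [Finset.mem_filter, Finset.mem_univ, true_and, Finset.mem_insert, Fin.ext_iff]
    omega
  rw [psum, psum, this, Finset.sum_insert (by simp), add_comm]

theorem psum_add_smul [CommRing R] (a b : R) (x y : Fin n → R) (i : ℕ) :
    psum (a • x + b • y) i = a * psum x i + b * psum y i := by
  simp only [psum, Pi.add_apply, Pi.smul_apply, smul_eq_mul, Finset.sum_add_distrib,
    Finset.mul_sum]

theorem psum_intCast (x : Fin n → ℤ) (i : ℕ) :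
    psum (fun j => (x j : ℝ)) i = (psum x i : ℤ) := by
  simp [psum]

theorem psum_eq_of_step [AddCommGroup R] {x : Fin n → R} {h : ℕ → R} (h0 : h 0 = 0)
    (hstep : ∀ j : Fin n, x j = h (j + 1) - h j) {i : ℕ} (hi : i ≤ n) : psum x i = h i := by
  induction i with
  | zero => rw [psum_zero, h0]
  | succ i ih =>
    have h1 := psum_succ x ⟨i, hi⟩
    have h2 := hstep ⟨i, hi⟩
    dsimp only at h1 h2
    rw [h1, ih (by omega), h2]
    abel

theorem pathHeight_eq_psum [CommSemiring R] (B : Finset (Fin n)) (i : ℕ) :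
    (pathHeight B i : R) = psum (fun j => if j ∈ B then (1 : R) else 0) i := by
  rw [pathHeight, psum, Finset.sum_boole]
  congr 2
  ext j
  simp [and_comm]

theorem pathHeight_zero (B : Finset (Fin n)) : pathHeight B 0 = 0 := by
  simp [pathHeight]

theorem pathHeight_succ (B : Finset (Fin n)) (j : Fin n) :
    pathHeight B (j + 1) = pathHeight B j + if j ∈ B then 1 else 0 := by
  have h := psum_succ (fun j => if j ∈ B then (1 : ℕ) else 0) j
  rwa [← pathHeight_eq_psum, ← pathHeight_eq_psum] at h

theorem pathHeight_eq_card (B : Finset (Fin n)) : pathHeight B n = B.card := by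
  rw [pathHeight, Finset.filter_true_of_mem fun j _ => j.isLt]

theorem exists_pathHeight_eq {h : ℕ → ℕ} (h0 : h 0 = 0)
    (hstep : ∀ j : Fin n, h j ≤ h (j + 1) ∧ h (j + 1) ≤ h j + 1) :
    ∃ B : Finset (Fin n), (∀ i ≤ n, pathHeight B i = h i) ∧
      ∀ j : Fin n, (j ∈ B ↔ h (j + 1) = h j + 1) := by
  have hmem : ∀ j : Fin n, (j ∈ Finset.univ.filter fun j : Fin n => h (j + 1) = h j + 1) ↔
      h (j + 1) = h j + 1 := by simp
  refine ⟨_, fun i hi => ?_, hmem⟩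
  induction i with
  | zero => rw [pathHeight_zero, h0]
  | succ i ih =>
    have h1 := pathHeight_succ (Finset.univ.filter fun j : Fin n => h (j + 1) = h j + 1) ⟨i, hi⟩
    have h2 := hmem ⟨i, hi⟩
    have h3 := hstep ⟨i, hi⟩
    dsimp only at h1 h2 h3
    rw [h1, ih (by omega)]
    split_ifs with h4
    · rw [h2.1 h4]
    · have := mt h2.2 h4
      omega

end PathSums

section Bases

variable {U L : Finset (Fin n)}

theorem mem_lpmBases_iff {B : Finset (Fin n)} : B ∈ lpmBases U L ↔ B.card = U.card ∧
    ∀ i ≤ n, pathHeight L i ≤ pathHeight B i ∧ pathHeight B i ≤ pathHeight U i := by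
  simp [lpmBases]

theorem upper_mem_lpmBases (hUL : IsLPMPair U L) : U ∈ lpmBases U L :=
  mem_lpmBases_iff.2 ⟨rfl, fun i _ => ⟨hUL.2 i, le_rfl⟩⟩

theorem lower_mem_lpmBases (hUL : IsLPMPair U L) : L ∈ lpmBases U L :=
  mem_lpmBases_iff.2 ⟨hUL.1.symm, fun i _ => ⟨le_rfl, hUL.2 i⟩⟩

theorem pathHeight_lower_eq_upper (hUL : IsLPMPair U L) : pathHeight L n = pathHeight U n := by
  rw [pathHeight_eq_card, pathHeight_eq_card, hUL.1]

theorem exists_mem_lpmBases_of_heights (hUL : IsLPMPair U L) {h : ℕ → ℕ}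
    (hstep : ∀ j : Fin n, h j ≤ h (j + 1) ∧ h (j + 1) ≤ h j + 1)
    (hbd : ∀ i ≤ n, pathHeight L i ≤ h i ∧ h i ≤ pathHeight U i) :
    ∃ B ∈ lpmBases U L, ∀ j : Fin n, (j ∈ B ↔ h (j + 1) = h j + 1) := by
  have h0 : h 0 = 0 := by
    have := hbd 0 (Nat.zero_le _)
    rw [pathHeight_zero, pathHeight_zero] at this
    omega
  obtain ⟨B, hB, hmem⟩ := exists_pathHeight_eq h0 hstep
  refine ⟨B, mem_lpmBases_iff.2 ⟨?_, fun i hi => by rw [hB i hi]; exact hbd i hi⟩, hmem⟩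
  have h1 := hbd n le_rfl
  rw [pathHeight_lower_eq_upper hUL] at h1
  rw [← pathHeight_eq_card, ← pathHeight_eq_card, hB n le_rfl]
  omega

theorem pathHeight_succ_le (B : Finset (Fin n)) (j : Fin n) :
    pathHeight B j ≤ pathHeight B (j + 1) ∧ pathHeight B (j + 1) ≤ pathHeight B j + 1 := by
  rw [pathHeight_succ]
  split_ifs <;> omega

theorem exists_basis_mem (hn : 2 ≤ n) (hUL : IsLPMPair U L) (hconn : ConnectedDiagram U L)
    (j : Fin n) : ∃ B ∈ lpmBases U L, j ∈ B := by
  by_cases hj : j ∈ L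
  · exact ⟨L, lower_mem_lpmBases hUL, hj⟩
  have hL := pathHeight_succ L j
  rw [if_neg hj, add_zero] at hL
  have hlt : pathHeight L (j + 1) < pathHeight U (j + 1) := by
    rcases Nat.lt_or_ge (j + 1) n with h | h
    · exact hconn _ (by omega) h
    · have h1 := hconn j (by omega) j.isLt
      have h2 := pathHeight_succ_le U j
      omega
  obtain ⟨B, hB, hmem⟩ := exists_mem_lpmBases_of_heights hUL
    (h := fun i => if i ≤ j then pathHeight L i else min (pathHeight L i + 1) (pathHeight U i))
    (fun i => by
      have h1 := pathHeight_succ_le L i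
      have h2 := pathHeight_succ_le U i
      rcases lt_trichotomy (i : ℕ) j with h | h | h
      · rw [if_pos h.le, if_pos (by omega)]
        exact h1
      · rw [if_pos h.le, if_neg (by omega), h]
        omega
      · rw [if_neg (by omega), if_neg (by omega)]
        omega)
    (fun i _ => by
      have h1 := hUL.2 i
      split_ifs <;> omega)
  refine ⟨B, hB, (hmem j).2 ?_⟩
  rw [if_pos le_rfl, if_neg (by omega)]
  omega

theorem exists_basis_notMem (hn : 2 ≤ n) (hUL : IsLPMPair U L) (hconn : ConnectedDiagram U L)
    (j : Fin n) : ∃ B ∈ lpmBases U L, j ∉ B := by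
  by_cases hj : j ∉ U
  · exact ⟨U, upper_mem_lpmBases hUL, hj⟩
  have hU := pathHeight_succ U j
  rw [if_pos (not_not.1 hj)] at hU
  have hlt : pathHeight L (j + 1) < pathHeight U (j + 1) := by
    rcases Nat.lt_or_ge (j + 1) n with h | h
    · exact hconn _ (by omega) h
    · have h1 := hconn j (by omega) j.isLt
      have h2 := pathHeight_succ_le L j
      omega
  obtain ⟨B, hB, hmem⟩ := exists_mem_lpmBases_of_heights hUL
    (h := fun i => if i ≤ j then pathHeight U i else max (pathHeight U i - 1) (pathHeight L i))
    (fun i => by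
      have h1 := pathHeight_succ_le L i
      have h2 := pathHeight_succ_le U i
      rcases lt_trichotomy (i : ℕ) j with h | h | h
      · rw [if_pos h.le, if_pos (by omega)]
        exact h2
      · rw [if_pos h.le, if_neg (by omega), h]
        omega
      · rw [if_neg (by omega), if_neg (by omega)]
        omega)
    (fun i _ => by
      have h1 := hUL.2 i
      split_ifs <;> omega)
  refine ⟨B, hB, fun h => ?_⟩
  have h1 := (hmem j).1 h
  rw [if_pos le_rfl, if_neg (by omega)] at h1
  omega

end Bases

section Slack

variable {R : Type*} {U L : Finset (Fin n)}

/-- The inequalities cutting out a lattice path matroid polytope. -/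
abbrev LPMIneq (n : ℕ) := (Fin n ⊕ Fin n) ⊕ ({i : Fin n // i.val ≠ 0} ⊕ {i : Fin n // i.val ≠ 0})

/-- The slack of `x` in the inequalities defining the `t`-th dilate of the polytope. -/
def slack [CommRing R] (U L : Finset (Fin n)) (t : R) (x : Fin n → R) : LPMIneq n → R
  | .inl (.inl j) => x j
  | .inl (.inr j) => t - x j
  | .inr (.inl i) => psum x i.val - t * pathHeight L i.val
  | .inr (.inr i) => t * pathHeight U i.val - psum x i.val

/-- The points satisfying the inequalities defining the `t`-th dilate of the polytope. -/
def IsDilatePoint [CommRing R] [PartialOrder R] (U L : Finset (Fin n)) (t : R) (x : Fin n → R) :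
    Prop :=
  psum x n = t * U.card ∧ ∀ a, 0 ≤ slack U L t x a

/-- The points strictly satisfying the inequalities defining the `t`-th dilate. -/
def IsInnerDilatePoint [CommRing R] [PartialOrder R] (U L : Finset (Fin n)) (t : R)
    (x : Fin n → R) : Prop :=
  psum x n = t * U.card ∧ ∀ a, 0 < slack U L t x a

theorem slack_add_smul [CommRing R] (a b s t : R) (x y : Fin n → R) (i : LPMIneq n) :
    slack U L (a * s + b * t) (a • x + b • y) i = a * slack U L s x i + b * slack U L t y i := by
  rcases i with (j | j) | (i | i)
  · simp [slack]
  · simp only [slack, Pi.add_apply, Pi.smul_apply, smul_eq_mul]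
    ring
  · simp only [slack, psum_add_smul]
    ring
  · simp only [slack, psum_add_smul]
    ring

theorem slack_intCast (t : ℤ) (x : Fin n → ℤ) (i : LPMIneq n) :
    slack U L (t : ℝ) (fun j => (x j : ℝ)) i = (slack U L t x i : ℤ) := by
  rcases i with (j | j) | (i | i) <;> simp [slack, psum_intCast]

theorem isDilatePoint_intCast (t : ℤ) (x : Fin n → ℤ) :
    IsDilatePoint U L (t : ℝ) (fun j => (x j : ℝ)) ↔ IsDilatePoint U L t x := by
  rw [IsDilatePoint, IsDilatePoint, psum_intCast]
  simp only [slack_intCast]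
  norm_cast

theorem isDilatePoint_basis [CommRing R] [LinearOrder R] [IsStrictOrderedRing R]
    {B : Finset (Fin n)} (hB : B ∈ lpmBases U L) :
    IsDilatePoint U L (1 : R) fun j => if j ∈ B then 1 else 0 := by
  rw [mem_lpmBases_iff] at hB
  refine ⟨by rw [← pathHeight_eq_psum, pathHeight_eq_card, hB.1, one_mul], ?_⟩
  rintro ((j | j) | (i | i))
  · simp only [slack]
    split_ifs <;> simp
  · simp only [slack]
    split_ifs <;> simp
  · simp only [slack, ← pathHeight_eq_psum, one_mul, sub_nonneg, Nat.cast_le]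
    exact (hB.2 i.val i.val.isLt.le).1
  · simp only [slack, ← pathHeight_eq_psum, one_mul, sub_nonneg, Nat.cast_le]
    exact (hB.2 i.val i.val.isLt.le).2

theorem exists_basis_slack_pos (hn : 2 ≤ n) (hUL : IsLPMPair U L) (hconn : ConnectedDiagram U L)
    (a : LPMIneq n) : ∃ B ∈ lpmBases U L, 0 < slack U L (1 : ℤ) (fun j => if j ∈ B then 1 else 0) a := by
  rcases a with (j | j) | (i | i)
  · obtain ⟨B, hB, hj⟩ := exists_basis_mem hn hUL hconn j
    exact ⟨B, hB, by simp [slack, hj]⟩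
  · obtain ⟨B, hB, hj⟩ := exists_basis_notMem hn hUL hconn j
    exact ⟨B, hB, by simp [slack, hj]⟩
  · refine ⟨U, upper_mem_lpmBases hUL, ?_⟩
    simp only [slack, ← pathHeight_eq_psum, one_mul, sub_pos, Nat.cast_lt]
    exact hconn _ (Nat.pos_of_ne_zero i.2) i.val.isLt
  · refine ⟨L, lower_mem_lpmBases hUL, ?_⟩
    simp only [slack, ← pathHeight_eq_psum, one_mul, sub_pos, Nat.cast_lt]
    exact hconn _ (Nat.pos_of_ne_zero i.2) i.val.isLt

theorem isDilatePoint_of_mem_lpmPolytope {x : Fin n → ℝ} (hx : x ∈ lpmPolytope U L) :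
    IsDilatePoint U L 1 x := by
  have hconv : Convex ℝ {x : Fin n → ℝ | IsDilatePoint U L 1 x} := by
    intro x hx y hy a b ha hb hab
    constructor
    · rw [psum_add_smul, hx.1, hy.1, ← add_mul, hab, one_mul]
    · intro i
      have h1 := slack_add_smul (U := U) (L := L) a b 1 1 x y i
      rw [mul_one, mul_one, hab] at h1
      rw [h1]
      exact add_nonneg (mul_nonneg ha (hx.2 i)) (mul_nonneg hb (hy.2 i))
  refine convexHull_min ?_ hconv hx
  rintro _ ⟨B, hB, rfl⟩
  exact isDilatePoint_basis hB

theorem isDilatePoint_of_mem_smul {t : ℝ} (ht : 0 ≤ t) {x : Fin n → ℝ}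
    (hx : x ∈ t • lpmPolytope U L) : IsDilatePoint U L t x := by
  obtain ⟨y, hy, rfl⟩ := hx
  have hy' := isDilatePoint_of_mem_lpmPolytope hy
  have h0 : ∀ i, slack U L t (t • y) i = t * slack U L 1 y i := fun i => by
    have h1 := slack_add_smul (U := U) (L := L) t 0 1 0 y 0 i
    simpa using h1
  refine ⟨?_, fun i => ?_⟩
  · have h1 := psum_add_smul t 0 y 0 n
    have h2 := hy'.1
    simp only [smul_zero, add_zero, zero_mul] at h1
    dsimp only
    rw [h1, h2, one_mul]
  · dsimp only
    rw [h0]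
    exact mul_nonneg ht (hy'.2 i)

theorem sum_range_add_div (t a : ℕ) (ht : 0 < t) : ∑ s ∈ Finset.range t, (a + s) / t = a := by
  induction a with
  | zero =>
    refine Finset.sum_eq_zero fun s hs => ?_
    rw [zero_add, Nat.div_eq_of_lt (Finset.mem_range.1 hs)]
  | succ a ih =>
    have h1 := Finset.sum_range_succ' (fun s => (a + s) / t) t
    rw [Finset.sum_range_succ, ih, Nat.add_div_right _ ht, add_zero] at h1
    have h2 : ∑ s ∈ Finset.range t, (a + 1 + s) / t = ∑ s ∈ Finset.range t, (a + (s + 1)) / t :=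
      Finset.sum_congr rfl fun s _ => by rw [add_assoc, add_comm 1 s]
    rw [h2]
    omega

theorem IsDilatePoint.heights {t : ℤ} {x : Fin n → ℤ} (hUL : IsLPMPair U L)
    (hx : IsDilatePoint U L t x) {i : ℕ} (hi : i ≤ n) :
    t * pathHeight L i ≤ psum x i ∧ psum x i ≤ t * pathHeight U i := by
  rcases Nat.eq_zero_or_pos i with rfl | h0
  · simp [pathHeight_zero, psum_zero]
  rcases hi.lt_or_eq with h1 | rfl
  · have h2 := hx.2 (.inr (.inl ⟨⟨i, h1⟩, h0.ne'⟩))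
    have h3 := hx.2 (.inr (.inr ⟨⟨i, h1⟩, h0.ne'⟩))
    simp only [slack] at h2 h3
    exact ⟨by linarith, by linarith⟩
  · rw [pathHeight_lower_eq_upper hUL, pathHeight_eq_card]
    exact ⟨hx.1.ge, hx.1.le⟩

theorem mem_smul_of_isDilatePoint (hUL : IsLPMPair U L) {t : ℕ} {x : Fin n → ℤ}
    (hx : IsDilatePoint U L (t : ℤ) x) :
    (fun j => (x j : ℝ)) ∈ (t : ℝ) • lpmPolytope U L := by
  have hx0 : ∀ j, 0 ≤ x j := fun j => hx.2 (.inl (.inl j))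
  have hxt : ∀ j, x j ≤ t := fun j => by
    have := hx.2 (.inl (.inr j))
    simp only [slack] at this
    linarith
  have hmemP : ∀ B ∈ lpmBases U L, indVec B ∈ lpmPolytope U L := fun B hB =>
    subset_convexHull ℝ _ ⟨B, hB, rfl⟩
  rcases Nat.eq_zero_or_pos t with rfl | ht
  · refine ⟨_, hmemP U (upper_mem_lpmBases hUL), ?_⟩
    funext j
    have h1 := hx0 j
    have h2 := hxt j
    have h3 : x j = 0 := by push_cast at h2; omega
    simp [h3]
  obtain ⟨S, hS⟩ : ∃ S : ℕ → ℕ, ∀ i, (S i : ℤ) = psum x i :=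
    ⟨fun i => (psum x i).toNat, fun i =>
      Int.toNat_of_nonneg (Finset.sum_nonneg fun j _ => hx0 j)⟩
  have hSstep : ∀ j : Fin n, (S (j + 1) : ℤ) = S j + x j := fun j => by
    rw [hS, hS, psum_succ]
  have hSbd : ∀ i ≤ n, t * pathHeight L i ≤ S i ∧ S i ≤ t * pathHeight U i := fun i hi => by
    have := hx.heights hUL hi
    rw [← hS] at this
    exact_mod_cast this
  have hB : ∀ s : ℕ, ∃ B : Finset (Fin n), s < t → B ∈ lpmBases U L ∧
      ∀ j : Fin n, (S (j + 1) + s) / t = (S j + s) / t + if j ∈ B then 1 else 0 := by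
    intro s
    by_cases hs : s < t
    swap
    · exact ⟨∅, fun h => absurd h hs⟩
    have hst : ∀ j : Fin n, (S j + s) / t ≤ (S (j + 1) + s) / t ∧
        (S (j + 1) + s) / t ≤ (S j + s) / t + 1 := fun j => by
      have h1 := hSstep j
      have h2 := hx0 j
      have h3 := hxt j
      rw [← Nat.add_div_right _ ht]
      exact ⟨Nat.div_le_div_right (by omega), Nat.div_le_div_right (by omega)⟩
    obtain ⟨B, hB, hmem⟩ := exists_mem_lpmBases_of_heights hUL
      (h := fun i => (S i + s) / t) hst (fun i hi => by
        obtain ⟨h1, h2⟩ := hSbd i hi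
        refine ⟨(Nat.le_div_iff_mul_le ht).2 (by rw [mul_comm]; omega), ?_⟩
        refine Nat.lt_succ_iff.1 ((Nat.div_lt_iff_lt_mul ht).2 ?_)
        rw [Nat.succ_mul, mul_comm]
        omega)
    refine ⟨B, fun _ => ⟨hB, fun j => ?_⟩⟩
    have h1 := hmem j
    have h2 := hst j
    split_ifs with h3
    · exact h1.1 h3
    · have := mt h1.2 h3
      omega
  choose B hB using hB
  have hsum : ∀ j, ∑ s ∈ Finset.range t, (if j ∈ B s then (1 : ℕ) else 0) = x j := by
    intro j
    have h1 : ∑ s ∈ Finset.range t, (S (j + 1) + s) / t = ∑ s ∈ Finset.range t, (S j + s) / t +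
        ∑ s ∈ Finset.range t, (if j ∈ B s then (1 : ℕ) else 0) := by
      rw [← Finset.sum_add_distrib]
      exact Finset.sum_congr rfl fun s hs => (hB s (Finset.mem_range.1 hs)).2 j
    rw [sum_range_add_div _ _ ht, sum_range_add_div _ _ ht] at h1
    have h2 := hSstep j
    rw [h1] at h2
    push_cast at h2 ⊢
    linarith
  have ht' : (t : ℝ) ≠ 0 := by exact_mod_cast ht.ne'
  refine ⟨∑ s ∈ Finset.range t, (t : ℝ)⁻¹ • indVec (B s), ?_, ?_⟩
  · refine (convex_convexHull ℝ _).sum_mem (fun _ _ => by positivity) ?_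
      fun s hs => hmemP _ (hB s (Finset.mem_range.1 hs)).1
    rw [Finset.sum_const, Finset.card_range, nsmul_eq_mul, mul_inv_cancel₀ ht']
  · funext j
    rw [← hsum j]
    simp only [Pi.smul_apply, Finset.sum_apply, smul_eq_mul, ← Finset.mul_sum, indVec]
    rw [mul_inv_cancel_left₀ ht']
    push_cast
    rfl

end Slack

section RelativeInterior

open Topology Filter

variable {V : Type*} [NormedAddCommGroup V] [NormedSpace ℝ V]

theorem mem_intrinsicInterior_iff_mem_nhdsWithin {S : Set V} {x : V} :
    x ∈ intrinsicInterior ℝ S ↔ x ∈ affineSpan ℝ S ∧ S ∈ 𝓝[affineSpan ℝ S] x := by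
  rw [mem_intrinsicInterior]
  constructor
  · rintro ⟨y, hy, rfl⟩
    exact ⟨y.2, preimage_coe_mem_nhds_subtype.1 (mem_interior_iff_mem_nhds.1 hy)⟩
  · rintro ⟨hx, hS⟩
    exact ⟨⟨x, hx⟩, mem_interior_iff_mem_nhds.2 (preimage_coe_mem_nhds_subtype.2 hS), rfl⟩

theorem exists_add_smul_sub_mem_of_mem_intrinsicInterior {S : Set V} {x y : V}
    (hx : x ∈ intrinsicInterior ℝ S) (hy : y ∈ S) : ∃ ε : ℝ, 0 < ε ∧ x + ε • (x - y) ∈ S := by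
  obtain ⟨hxS, hS⟩ := mem_intrinsicInterior_iff_mem_nhdsWithin.1 hx
  have hlim : Tendsto (fun ε : ℝ => x + ε • (x - y)) (𝓝[>] 0) (𝓝[affineSpan ℝ S] x) := by
    refine tendsto_nhdsWithin_iff.2 ⟨?_, Eventually.of_forall fun ε => ?_⟩
    · have h1 : Continuous fun ε : ℝ => x + ε • (x - y) := by fun_prop
      have h2 := (h1.tendsto 0).mono_left (nhdsWithin_le_nhds (s := Set.Ioi 0))
      simpa using h2
    · have h1 := AffineMap.lineMap_mem (1 + ε) (subset_affineSpan ℝ S hy) hxS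
      have h2 : x + ε • (x - y) = (1 + ε) • (x - y) + y := by module
      rw [AffineMap.lineMap_apply_module', ← h2] at h1
      exact h1
  obtain ⟨ε, h1, h2⟩ := ((hlim.eventually hS).and self_mem_nhdsWithin).exists
  exact ⟨ε, h2, h1⟩

theorem mem_intrinsicInterior_of_forall_exists [FiniteDimensional ℝ V] {S : Set V}
    (hS : Convex ℝ S) {x : V} (hx : x ∈ S)
    (h : ∀ y ∈ S, ∃ ε : ℝ, 0 < ε ∧ x + ε • (x - y) ∈ S) : x ∈ intrinsicInterior ℝ S := by
  obtain ⟨z, hz⟩ := Set.Nonempty.intrinsicInterior hS ⟨x, hx⟩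
  obtain ⟨ε, hε, hw⟩ := h z (intrinsicInterior_subset hz)
  obtain ⟨hzS, hzN⟩ := mem_intrinsicInterior_iff_mem_nhdsWithin.1 hz
  obtain ⟨w, hwdef⟩ : ∃ w, w = x + ε • (x - z) := ⟨_, rfl⟩
  rw [← hwdef] at hw
  refine mem_intrinsicInterior_iff_mem_nhdsWithin.2 ⟨subset_affineSpan ℝ S hx, ?_⟩
  have hlim : Tendsto (fun u => AffineMap.lineMap w u (1 + ε⁻¹)) (𝓝[affineSpan ℝ S] x)
      (𝓝[affineSpan ℝ S] z) := by
    refine tendsto_nhdsWithin_iff.2 ⟨?_, ?_⟩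
    · have h1 : Continuous fun u => AffineMap.lineMap w u (1 + ε⁻¹) := by
        simp only [AffineMap.lineMap_apply_module']
        fun_prop
      have h2 := (h1.tendsto x).mono_left (nhdsWithin_le_nhds (s := affineSpan ℝ S))
      have h3 : AffineMap.lineMap w x (1 + ε⁻¹) = z := by
        rw [AffineMap.lineMap_apply_module', hwdef]
        match_scalars
        · field_simp
          ring
        · field_simp
          ring
      rwa [h3] at h2
    · filter_upwards [self_mem_nhdsWithin] with u hu
      exact AffineMap.lineMap_mem _ (subset_affineSpan ℝ S hw) hu
  filter_upwards [hlim.eventually hzN] with u hu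
  have h1 := hS hw hu (a := (1 + ε)⁻¹) (b := ε * (1 + ε)⁻¹) (by positivity) (by positivity)
    (by field_simp)
  convert h1 using 1
  rw [AffineMap.lineMap_apply_module']
  match_scalars
  · field_simp
    ring
  · field_simp
    ring

end RelativeInterior

section LatticePoints

variable {U L : Finset (Fin n)}

theorem latticeCount_eq_ncard (S : Set (Fin n → ℝ)) :
    latticeCount S = Set.ncard {x : Fin n → ℤ | (fun j => (x j : ℝ)) ∈ S} := by
  have hinj : Function.Injective fun (x : Fin n → ℤ) (j : Fin n) => (x j : ℝ) := fun x y h =>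
    funext fun j => Int.cast_injective (congrFun h j)
  rw [latticeCount, ← Set.ncard_image_of_injective _ hinj]
  congr 1
  ext y
  constructor
  · rintro ⟨hy, hint⟩
    choose x hx using hint
    obtain rfl : y = fun j => (x j : ℝ) := funext hx
    exact ⟨x, hy, rfl⟩
  · rintro ⟨x, hx, rfl⟩
    exact ⟨hx, fun j => ⟨x j, rfl⟩⟩

theorem mem_smul_lpmPolytope_iff (hUL : IsLPMPair U L) (t : ℕ) (x : Fin n → ℤ) :
    (fun j => (x j : ℝ)) ∈ (t : ℝ) • lpmPolytope U L ↔ IsDilatePoint U L (t : ℤ) x :=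
  ⟨fun h => (isDilatePoint_intCast _ _).1 (isDilatePoint_of_mem_smul (Nat.cast_nonneg t) h),
    mem_smul_of_isDilatePoint hUL⟩

theorem mem_intrinsicInterior_smul_lpmPolytope_iff (hn : 2 ≤ n) (hUL : IsLPMPair U L)
    (hconn : ConnectedDiagram U L) {s : ℕ} (hs : 1 ≤ s) (x : Fin n → ℤ) :
    (fun j => (x j : ℝ)) ∈ intrinsicInterior ℝ ((s : ℝ) • lpmPolytope U L) ↔
      IsInnerDilatePoint U L (s : ℤ) x := by
  have hs0 : (0 : ℝ) < s := by exact_mod_cast hs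
  have hint : ∀ B : Finset (Fin n),
      indVec B = fun j => ((if j ∈ B then 1 else 0 : ℤ) : ℝ) := fun B => by
    funext j
    simp [indVec]
  constructor
  · intro hx
    have hxd := (mem_smul_lpmPolytope_iff hUL s x).1 (intrinsicInterior_subset hx)
    refine ⟨hxd.1, fun a => ?_⟩
    obtain ⟨B, hB, hpos⟩ := exists_basis_slack_pos hn hUL hconn a
    obtain ⟨ε, hε, hmem⟩ := exists_add_smul_sub_mem_of_mem_intrinsicInterior hx
      (Set.smul_mem_smul_set (a := (s : ℝ)) (subset_convexHull ℝ _ ⟨B, hB, rfl⟩))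
    have h1 := (isDilatePoint_of_mem_smul hs0.le hmem).2 a
    have h2 := slack_add_smul (U := U) (L := L) (1 + ε) (-(ε * s)) (s : ℝ) 1
      (fun j => (x j : ℝ)) (indVec B) a
    rw [show (1 + ε) * (s : ℝ) + -(ε * s) * 1 = s by ring,
      show (1 + ε) • (fun j => (x j : ℝ)) + (-(ε * s)) • indVec B =
        (fun j => (x j : ℝ)) + ε • ((fun j => (x j : ℝ)) - (s : ℝ) • indVec B) by module] at h2
    rw [h2, hint B] at h1
    have h3 := slack_intCast (U := U) (L := L) s x a
    have h4 := slack_intCast (U := U) (L := L) 1 (fun j => if j ∈ B then 1 else 0) a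
    rw [Int.cast_natCast] at h3
    rw [Int.cast_one] at h4
    rw [h3, h4] at h1
    have h5 : (1 : ℝ) ≤ (slack U L 1 (fun j => if j ∈ B then 1 else 0) a : ℤ) := by
      exact_mod_cast hpos
    have h6 : 0 < (1 + ε) * (slack U L (s : ℤ) x a : ℤ) := by
      have : 0 < ε * s := by positivity
      nlinarith
    have h7 : (0 : ℝ) < (slack U L (s : ℤ) x a : ℤ) := pos_of_mul_pos_right h6 (by positivity)
    exact_mod_cast h7
  · intro hx
    have hxd : IsDilatePoint U L (s : ℤ) x := ⟨hx.1, fun a => (hx.2 a).le⟩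
    have hconv : Convex ℝ ((s : ℝ) • lpmPolytope U L) := (convex_convexHull ℝ _).smul _
    obtain ⟨K, hK0, hK⟩ : ∃ K : ℕ, 0 < K ∧ ∀ B ∈ lpmBases U L, ∀ a,
        s * slack U L (1 : ℤ) (fun j => if j ∈ B then 1 else 0) a ≤ K := by
      obtain ⟨K, hK⟩ := (Set.finite_range fun p : Finset (Fin n) × LPMIneq n =>
        s * slack U L (1 : ℤ) (fun j => if j ∈ p.1 then 1 else 0) p.2).bddAbove
      refine ⟨K.toNat + 1, Nat.succ_pos _, fun B _ a => ?_⟩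
      have := hK ⟨(B, a), rfl⟩
      dsimp only at this
      omega
    have hK0' : (0 : ℝ) < K := by exact_mod_cast hK0
    have hvert : ∀ z ∈ lpmPolytope U L,
        (1 + (K : ℝ)⁻¹) • (fun j => (x j : ℝ)) + (-((K : ℝ)⁻¹ * s)) • z ∈
          (s : ℝ) • lpmPolytope U L := by
      intro z hz
      have hc : Convex ℝ {z : Fin n → ℝ | (1 + (K : ℝ)⁻¹) • (fun j => (x j : ℝ)) +
          (-((K : ℝ)⁻¹ * s)) • z ∈ (s : ℝ) • lpmPolytope U L} := by
        intro z hz z' hz' a b ha hb hab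
        have h1 := hconv hz hz' ha hb hab
        have h2 : b = 1 - a := by linarith
        subst h2
        rw [Set.mem_ofPred_eq]
        convert h1 using 1
        module
      refine convexHull_min ?_ hc hz
      rintro _ ⟨B, hB, rfl⟩
      have h1 : IsDilatePoint U L ((K * s : ℕ) : ℤ)
          (((K + 1 : ℕ) : ℤ) • x + (-(s : ℤ)) • fun j => if j ∈ B then 1 else 0) := by
        have hBd := isDilatePoint_basis (R := ℤ) hB
        have hlev : ((K * s : ℕ) : ℤ) = ((K + 1 : ℕ) : ℤ) * s + (-(s : ℤ)) * 1 := by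
          push_cast
          ring
        constructor
        · rw [psum_add_smul, hxd.1, hBd.1, hlev]
          ring
        · intro a
          rw [hlev, slack_add_smul]
          have h2 := hx.2 a
          have h3 := hK B hB a
          push_cast
          nlinarith
      obtain ⟨w, hw, hwx⟩ := mem_smul_of_isDilatePoint hUL h1
      refine ⟨w, hw, ?_⟩
      funext j
      have h2 := congrFun hwx j
      simp only [Pi.smul_apply, Pi.add_apply, smul_eq_mul, indVec] at h2 ⊢
      push_cast at h2
      have h3 : (s : ℝ) * w j = (K : ℝ)⁻¹ * (K * s * w j) := by field_simp
      rw [h3, h2]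
      field_simp
    refine mem_intrinsicInterior_of_forall_exists hconv
      ((mem_smul_lpmPolytope_iff hUL s x).2 hxd) ?_
    rintro _ ⟨z, hz, rfl⟩
    refine ⟨(K : ℝ)⁻¹, by positivity, ?_⟩
    convert hvert z hz using 1
    dsimp only
    module

end LatticePoints

section DifferenceSystem

variable {U L : Finset (Fin n)}

/-- The cyclic successor. -/
def cyclicSucc (j : Fin n) : Fin n :=
  if h : j + 1 < n then ⟨j + 1, h⟩ else ⟨0, Nat.zero_lt_of_lt j.isLt⟩

theorem psum_succ_eq_cyclicSucc {t k : ℤ} {x : Fin n → ℤ} (hx : psum x n = t * k) (j : Fin n) :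
    psum x (j + 1) = psum x (cyclicSucc j) + (if j.val + 1 < n then 0 else k) * t := by
  rw [cyclicSucc]
  split_ifs with h
  · simp
  · rw [show (j : ℕ) + 1 = n by omega, hx, psum_zero]
    ring

variable [NeZero n]

/-- The larger side of each inequality, in terms of partial sums. -/
def ineqDst : LPMIneq n → Fin n
  | .inl (.inl j) => cyclicSucc j
  | .inl (.inr j) => j
  | .inr (.inl i) => i
  | .inr (.inr _) => 0

/-- The smaller side of each inequality, in terms of partial sums. -/
def ineqSrc : LPMIneq n → Fin n
  | .inl (.inl j) => j
  | .inl (.inr j) => cyclicSucc j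
  | .inr (.inl _) => 0
  | .inr (.inr i) => i

/-- The constant term of each inequality, in terms of partial sums. -/
def ineqConst (U L : Finset (Fin n)) : LPMIneq n → ℤ
  | .inl (.inl j) => if j.val + 1 < n then 0 else U.card
  | .inl (.inr j) => 1 - (if j.val + 1 < n then 0 else U.card : ℤ)
  | .inr (.inl i) => -pathHeight L i.val
  | .inr (.inr i) => pathHeight U i.val

theorem slack_eq_psum {t : ℤ} {x : Fin n → ℤ} (hx : psum x n = t * U.card) (a : LPMIneq n) :
    slack U L t x a = psum x (ineqDst a) + ineqConst U L a * t - psum x (ineqSrc a) := by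
  rcases a with (j | j) | (i | i)
  · have h1 := psum_succ_eq_cyclicSucc hx j
    have h2 := psum_succ x j
    simp only [slack, ineqDst, ineqSrc, ineqConst]
    linarith
  · have h1 := psum_succ_eq_cyclicSucc hx j
    have h2 := psum_succ x j
    simp only [slack, ineqDst, ineqSrc, ineqConst]
    linarith
  · simp only [slack, ineqDst, ineqSrc, ineqConst, Fin.val_zero, psum_zero]
    ring
  · simp only [slack, ineqDst, ineqSrc, ineqConst, Fin.val_zero, psum_zero]
    ring

/-- The partial sums of `x`. -/
def partialSums (x : Fin n → ℤ) (i : Fin n) : ℤ := psum x i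

theorem partialSums_injOn (s : ℤ) : Set.InjOn partialSums {x : Fin n → ℤ | psum x n = s} := by
  intro x hx y hy h
  have hi : ∀ i ≤ n, psum x i = psum y i := fun i hi => by
    rcases hi.lt_or_eq with h1 | rfl
    · exact congrFun h ⟨i, h1⟩
    · rw [hx.out, hy.out]
  funext j
  have h1 := psum_succ x j
  have h2 := psum_succ y j
  rw [hi _ j.isLt, hi _ j.isLt.le] at h1
  linarith

theorem exists_partialSums_eq {f : Fin n → ℤ} (hf : f 0 = 0) (s : ℤ) :
    ∃ x, psum x n = s ∧ partialSums x = f := by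
  obtain ⟨h, hh⟩ : ∃ h : ℕ → ℤ, ∀ i, h i = if hi : i < n then f ⟨i, hi⟩ else s := ⟨_, fun _ => rfl⟩
  have h0 : h 0 = 0 := by
    rw [hh, dif_pos (Nat.pos_of_neZero n)]
    exact hf
  have hx : ∀ i ≤ n, psum (fun j : Fin n => h (j + 1) - h j) i = h i := fun i hi =>
    psum_eq_of_step h0 (fun _ => rfl) hi
  refine ⟨_, (hx n le_rfl).trans (by rw [hh, dif_neg (lt_irrefl n)]), funext fun i => ?_⟩
  rw [partialSums, hx _ i.isLt.le, hh, dif_pos i.isLt]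

theorem image_partialSums_isDilatePoint (t : ℤ) :
    partialSums '' {x | IsDilatePoint U L t x} =
      {f | IsSol 0 ineqSrc ineqDst (ineqConst U L) t f} := by
  have key : ∀ x, psum x n = t * U.card → (IsDilatePoint U L t x ↔
      IsSol 0 ineqSrc ineqDst (ineqConst U L) t (partialSums x)) := fun x hx => by
    simp only [IsDilatePoint, IsSol, slack_eq_psum hx, partialSums, Fin.val_zero, psum_zero, hx,
      sub_nonneg]
  ext f
  constructor
  · rintro ⟨x, hx, rfl⟩
    exact (key x hx.1).1 hx
  · intro hf
    obtain ⟨x, hx, rfl⟩ := exists_partialSums_eq hf.1 (t * U.card)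
    exact ⟨x, (key x hx).2 hf, rfl⟩

theorem image_partialSums_isInnerDilatePoint (t : ℤ) :
    partialSums '' {x | IsInnerDilatePoint U L t x} =
      {f | IsStrictSol 0 ineqSrc ineqDst (ineqConst U L) t f} := by
  have key : ∀ x, psum x n = t * U.card → (IsInnerDilatePoint U L t x ↔
      IsStrictSol 0 ineqSrc ineqDst (ineqConst U L) t (partialSums x)) := fun x hx => by
    simp only [IsInnerDilatePoint, IsStrictSol, slack_eq_psum hx, partialSums, Fin.val_zero,
      psum_zero, hx, sub_pos]
  ext f
  constructor
  · rintro ⟨x, hx, rfl⟩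
    exact (key x hx.1).1 hx
  · intro hf
    obtain ⟨x, hx, rfl⟩ := exists_partialSums_eq hf.1 (t * U.card)
    exact ⟨x, (key x hx).2 hf, rfl⟩

theorem latticeCount_smul_lpmPolytope (hUL : IsLPMPair U L) (t : ℕ) :
    latticeCount ((t : ℝ) • lpmPolytope U L) =
      Set.ncard {f | IsSol 0 ineqSrc ineqDst (ineqConst U L) t f} := by
  rw [latticeCount_eq_ncard, ← image_partialSums_isDilatePoint,
    ((partialSums_injOn (t * U.card)).mono fun x hx => hx.1).ncard_image]
  simp only [mem_smul_lpmPolytope_iff hUL]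

theorem latticeCount_intrinsicInterior_smul_lpmPolytope (hn : 2 ≤ n) (hUL : IsLPMPair U L)
    (hconn : ConnectedDiagram U L) {s : ℕ} (hs : 1 ≤ s) :
    latticeCount (intrinsicInterior ℝ ((s : ℝ) • lpmPolytope U L)) =
      Set.ncard {f | IsStrictSol 0 ineqSrc ineqDst (ineqConst U L) s f} := by
  rw [latticeCount_eq_ncard, ← image_partialSums_isInnerDilatePoint,
    ((partialSums_injOn (s * U.card)).mono fun x hx => hx.1).ncard_image]
  simp only [mem_intrinsicInterior_smul_lpmPolytope_iff hn hUL hconn hs]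

theorem abs_le_of_isSol_ineq {t : ℕ} {f : Fin n → ℤ}
    (hf : IsSol 0 ineqSrc ineqDst (ineqConst U L) t f) (i : Fin n) : |f i| ≤ n * t := by
  have hf' : f ∈ partialSums '' {x | IsDilatePoint U L (t : ℤ) x} := by
    rw [image_partialSums_isDilatePoint]
    exact hf
  obtain ⟨x, hx, rfl⟩ := hf'
  have h0 : ∀ j, 0 ≤ x j := fun j => hx.2 (.inl (.inl j))
  have h1 : ∀ j, x j ≤ t := fun j => sub_nonneg.1 (hx.2 (.inl (.inr j)))
  rw [partialSums, psum, abs_of_nonneg (Finset.sum_nonneg fun j _ => h0 j)]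
  calc ∑ j ∈ Finset.univ.filter (fun j : Fin n => j.val < i), x j ≤ ∑ j, x j :=
        Finset.sum_le_sum_of_subset_of_nonneg (Finset.filter_subset _ _) fun j _ _ => h0 j
    _ ≤ ∑ _j : Fin n, (t : ℤ) := Finset.sum_le_sum fun j _ => h1 j
    _ = n * t := by simp

end DifferenceSystem

/-- If `M = M[U,L]` is a connected lattice path matroid on `[n]`
whose base polytope is Gorenstein, then the `h*`-vector of `P_M` is unimodal. -/
theorem gorenstein_lpm_hstar_unimodal (U L : Finset (Fin n))
    (hUL : IsLPMPair U L) (hconn : ConnectedDiagram U L)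
    (hGor : IsGorenstein (lpmPolytope U L)) :
    ∀ h : ℕ → ℕ, IsHStarVector (lpmPolytope U L) (n - 1) h →
      ∃ t : ℕ, (∀ i j : ℕ, i ≤ j → j ≤ t → h i ≤ h j) ∧
        (∀ i j : ℕ, t ≤ i → i ≤ j → h j ≤ h i) := by
  intro h hh
  rcases Nat.lt_or_ge n 2 with hn | hn
  · refine ⟨0, fun i j hij hj => ?_, fun i j _ hij => ?_⟩
    · rw [show i = j by omega]
    · rcases hij.lt_or_eq with hlt | rfl
      · rw [hh.2 j (by omega)]
        exact Nat.zero_le _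
      · exact le_rfl
  have : NeZero n := ⟨by omega⟩
  obtain ⟨δ, hδ, hG⟩ := hGor
  obtain ⟨k, hk⟩ := exists_gammaCone_of_ncard_eq (o := (0 : Fin n)) (src := ineqSrc)
    (dst := ineqDst) (c := ineqConst U L) (δ := δ) (κ := n) (by simpa using hn) hδ
    (Nat.cast_nonneg n) (fun t f hf => abs_le_of_isSol_ineq hf) fun t => by
      rw [← latticeCount_smul_lpmPolytope hUL, ← hG t,
        latticeCount_intrinsicInterior_smul_lpmPolytope hn hUL hconn (by omega)]
  simp only [← latticeCount_smul_lpmPolytope hUL] at hk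
  have hn1 : Fintype.card (Fin n) = n - 1 + 1 := by
    rw [Fintype.card_fin]
    omega
  rw [hn1, one_sub_pow_mul_mk_eq_mk hh.1 hh.2] at hk
  exact exists_unimodal_of_mem_gammaCone hk

end Unimodal
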